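/- arXiv:1803.08755 — 5 statements merged into one kernel-verified Lean document; each statement's English description precedes it below -/
import Mathlib

section
/- Let d ≥ 4 be an integer and let m, n be integers with m ≥ 2, n ≥ 2 and d = mn. If m(m-1) ≥ 2n, then D_d(m,n;H) ≍ H^m, i.e. there exist constants c₁, c₂ > 0 (depending only on d) such that for all integers H ≥ 2, c₁·H^m ≤ D_d(m,n;H) ≤ c₂·H^m. -/
open Polynomial

/-- The height of an integer polynomial is at most `H`. -/
def HeightLe (f : ℤ[X]) (H : ℕ) : Prop := ∀ i, |f.coeff i| ≤ (H : ℤ)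

/-- `DMonic d m n H` is the number of monic integer polynomials of degree `d` and
height at most `H` that are a composition `g ∘ h` with `deg g = m`, `deg h = n`. -/
noncomputable def DMonic (d m n : ℕ) (H : ℕ) : ℕ :=
  Nat.card {f : ℤ[X] // f.Monic ∧ f.natDegree = d ∧ HeightLe f H ∧
    ∃ g h : ℤ[X], g.natDegree = m ∧ h.natDegree = n ∧ f = g.comp h}


lemma normalize_decomp (m n : ℕ) (hm : m ≠ 0) (hn : n ≠ 0) (f g h : ℤ[X]) (hf : f.Monic)
    (hg : g.natDegree = m) (hh : h.natDegree = n) (hfg : f = g.comp h) :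
    ∃ g' h' : ℤ[X], g'.Monic ∧ h'.Monic ∧ g'.natDegree = m ∧ h'.natDegree = n ∧
      h'.coeff 0 = 0 ∧ f = g'.comp h' := by
  have hl : g.leadingCoeff * h.leadingCoeff ^ m = 1 := by
    have := leadingCoeff_comp (p := g) (q := h) (by omega)
    rw [← hfg, hf.leadingCoeff, hg] at this
    exact this.symm
  have hu : IsUnit h.leadingCoeff := by
    have : IsUnit (h.leadingCoeff ^ m) := IsUnit.of_mul_eq_one _ (by rw [mul_comm]; exact hl)
    exact (isUnit_pow_iff hm).1 this
  have hu2 : h.leadingCoeff * h.leadingCoeff = 1 := Int.isUnit_mul_self hu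
  set u := h.leadingCoeff with hudef
  have hu0 : u ≠ 0 := by rintro h0; rw [h0] at hu2; simp at hu2
  have hd1 : (C u * h).natDegree = n := by rw [natDegree_C_mul hu0, hh]
  have hd2 : (C u * h - C (u * h.coeff 0)).natDegree = n := by rw [natDegree_sub_C, hd1]
  have hd3 : (C u * X + C (h.coeff 0)).natDegree = 1 := natDegree_linear hu0
  have hd4 : (g.comp (C u * X + C (h.coeff 0))).natDegree = m := by
    rw [natDegree_comp, hg, hd3, mul_one]
  refine ⟨g.comp (C u * X + C (h.coeff 0)), C u * h - C (u * h.coeff 0), ?_, ?_, hd4, hd2, ?_, ?_⟩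
  · unfold Monic
    rw [leadingCoeff_comp (by omega), leadingCoeff_linear hu0, hg, hl]
  · unfold Monic leadingCoeff
    rw [hd2, coeff_sub, coeff_C_mul, coeff_C_of_ne_zero hn, ← hh]
    simpa using hu2
  · simp
  · rw [comp_assoc, hfg]
    congr 1
    simp only [add_comp, mul_comp, C_comp, X_comp]
    have : (C u : ℤ[X]) * C u = 1 := by rw [← C_mul, hu2, C_1]
    rw [C_mul]
    linear_combination (-h + C (h.coeff 0)) * this

lemma coeff_prod_bound (B : ℝ) (hB : 0 ≤ B) (s : Multiset ℂ) : ∀ j : ℕ,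
    ‖((s.map (fun y => X - C y)).prod).coeff j‖ * B ^ j ≤
      2 ^ (Multiset.card s) * (s.map (fun y => max B ‖y‖)).prod := by
  induction s using Multiset.induction_on with
  | empty =>
    intro j
    rcases j with _ | j <;> simp [coeff_one]
  | cons a s ih =>
    intro j
    simp only [Multiset.map_cons, Multiset.prod_cons, Multiset.card_cons]
    set p := (s.map (fun y => X - C y)).prod
    set P := (s.map (fun y => max B ‖y‖)).prod with hP
    have hP0 : 0 ≤ 2 ^ (Multiset.card s) * P := le_trans (by positivity) (ih 0)
    have h2 : ‖a‖ * (‖p.coeff j‖ * B ^ j) ≤ max B ‖a‖ * (2 ^ (Multiset.card s) * P) :=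
      mul_le_mul (le_max_right _ _) (ih j) (by positivity) (by positivity)
    rcases j with _ | j
    · simp only [sub_mul, coeff_sub, mul_coeff_zero, coeff_X_zero, zero_mul, zero_sub, norm_neg,
        norm_mul, coeff_C_zero]
      have : 0 ≤ max B ‖a‖ * (2 ^ (Multiset.card s) * P) := by positivity
      rw [pow_succ]
      linarith
    · have h1 : B * (‖p.coeff j‖ * B ^ j) ≤ max B ‖a‖ * (2 ^ (Multiset.card s) * P) :=
        mul_le_mul (le_max_left _ _) (ih j) (by positivity) (by positivity)
      rw [sub_mul, coeff_sub, coeff_X_mul, coeff_C_mul]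
      calc _ ≤ (‖p.coeff j‖ + ‖a‖ * ‖p.coeff (j+1)‖) * B ^ (j+1) := by
            gcongr
            rw [← norm_mul]
            exact norm_sub_le _ _
        _ = B * (‖p.coeff j‖ * B ^ j) + ‖a‖ * (‖p.coeff (j+1)‖ * B ^ (j+1)) := by ring
        _ ≤ _ := by rw [pow_succ 2 (Multiset.card s)]; linarith

lemma norm_coeff_le_two_pow (p : ℂ[X]) (i : ℕ) :
    ‖p.coeff i‖ ≤ 2 ^ p.natDegree * p.mahlerMeasure := by
  refine (norm_coeff_le_choose_mul_mahlerMeasure i p).trans ?_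
  gcongr
  · exact p.mahlerMeasure_nonneg
  · exact_mod_cast Nat.choose_le_two_pow _ _

lemma max_le_mahler (q : ℂ[X]) (i : ℕ) (y : ℂ) (k : ℕ) (hk : (X * q).natDegree = k) :
    max ‖q.coeff i‖ ‖y‖ ≤ 2 ^ k * (X * q - C y).mahlerMeasure := by
  have hd : (X * q - C y).natDegree = k := by rw [natDegree_sub_C, hk]
  apply max_le
  · have := norm_coeff_le_two_pow (X * q - C y) (i+1)
    rw [hd, coeff_sub, coeff_X_mul, coeff_C_of_ne_zero (by omega), sub_zero] at this
    exact this
  · have := norm_coeff_le_two_pow (X * q - C y) 0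
    rw [hd, coeff_sub, mul_coeff_zero, coeff_X_zero, zero_mul, coeff_C_zero, zero_sub,
      norm_neg] at this
    exact this

lemma mahler_le_height (f : ℤ[X]) (d H : ℕ) (hd : f.natDegree = d) (hf : HeightLe f H) :
    (f.map (Int.castRingHom ℂ)).mahlerMeasure ≤ (d + 1) * H := by
  refine (mahlerMeasure_le_sum_norm_coeff _).trans ?_
  rw [sum_over_range _ (by simp)]
  have hd' : (f.map (Int.castRingHom ℂ)).natDegree = d := by
    rw [natDegree_map_eq_of_injective (RingHom.injective_int _), hd]
  rw [hd']
  calc _ ≤ ∑ i ∈ Finset.range (d+1), (H:ℝ) := by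
        apply Finset.sum_le_sum
        intro i _
        rw [coeff_map, eq_intCast, Complex.norm_intCast]
        exact_mod_cast hf i
    _ = _ := by simp

lemma key_bound (m k H : ℕ) (g q : ℤ[X]) (hg : g.Monic) (hq : q.Monic)
    (hgm : g.natDegree = m) (hqk : q.natDegree = k) (hH : HeightLe (g.comp (X * q)) H) (i j : ℕ) :
    (g.coeff j).natAbs * (q.coeff i).natAbs ^ j ≤
      (2 ^ m * (2 ^ (k+1)) ^ m * (m * (k+1) + 1)) * H := by
  set φ := Int.castRingHom ℂ
  have hφ : Function.Injective φ := RingHom.injective_int _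
  set G := g.map φ
  set Q := q.map φ
  have hG : G.Monic := hg.map _
  have hXq : (X * q).natDegree = k + 1 := by rw [natDegree_X_mul hq.ne_zero, hqk]
  have hXQ : (X * Q).natDegree = k + 1 := by
    rw [← hXq, ← natDegree_map_eq_of_injective hφ (X * q)]; simp [Q]
  have hM : (G.comp (X * Q)).mahlerMeasure ≤ ((m * (k+1) : ℕ) + 1) * H := by
    have := mahler_le_height (g.comp (X * q)) (m * (k+1)) H (by rw [natDegree_comp, hgm, hXq]) hH
    rw [Polynomial.map_comp, Polynomial.map_mul, map_X] at this
    exact this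
  have hprod := (IsAlgClosed.splits G).eq_prod_roots_of_monic hG
  have hcard : Multiset.card G.roots = m := by
    rw [← (IsAlgClosed.splits G).natDegree_eq_card_roots, natDegree_map_eq_of_injective hφ, hgm]
  have hMprod : (G.comp (X * Q)).mahlerMeasure =
      (G.roots.map (fun y => (X * Q - C y).mahlerMeasure)).prod := by
    conv_lhs => rw [hprod]
    rw [multiset_prod_comp, prod_mahlerMeasure_eq_mahlerMeasure_prod, Multiset.map_map,
      Multiset.map_map]
    congr 1
    apply Multiset.map_congr rfl
    intro y _
    simp
  have hB : (G.roots.map (fun y => max ‖Q.coeff i‖ ‖y‖)).prod ≤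
      (2 ^ (k+1)) ^ m * (G.comp (X * Q)).mahlerMeasure := by
    rw [hMprod, ← hcard, ← Multiset.prod_replicate, ← Multiset.map_const', ← Multiset.prod_map_mul]
    apply Multiset.prod_map_le_prod_map₀
    · intro y _; positivity
    · intro y _; exact max_le_mahler Q i y (k+1) hXQ
  have h1 := coeff_prod_bound ‖Q.coeff i‖ (norm_nonneg _) G.roots j
  rw [← hprod, hcard] at h1
  have h2 : ‖G.coeff j‖ * ‖Q.coeff i‖ ^ j ≤
      (2 ^ m * (2 ^ (k+1)) ^ m * (m * (k+1) + 1)) * H := by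
    calc _ ≤ _ := h1
      _ ≤ 2 ^ m * ((2 ^ (k+1)) ^ m * (((m * (k+1) : ℕ) + 1) * H)) := by
        gcongr
        exact hB.trans (by gcongr)
      _ = _ := by push_cast; ring
  have e : ∀ (p : ℤ[X]) (l : ℕ), ‖(p.map φ).coeff l‖ = ((p.coeff l).natAbs : ℝ) := by
    intro p l
    rw [coeff_map, eq_intCast, Complex.norm_intCast, Nat.cast_natAbs, Int.cast_abs]
  rw [e, e] at h2
  exact_mod_cast h2

/-- The monic polynomial of degree `k` with lower coefficients `u`. -/
noncomputable def polyOf (k : ℕ) (u : Fin k → ℤ) : ℤ[X] :=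
  X ^ k + ∑ i : Fin k, C (u i) * X ^ (i : ℕ)

lemma eq_polyOf (k : ℕ) (p : ℤ[X]) (hp : p.Monic) (hk : p.natDegree = k) :
    p = polyOf k (fun i => p.coeff i) := by
  have := hp.as_sum
  rw [hk, Finset.sum_range] at this
  exact this

lemma polyOf_coeff (k : ℕ) (u : Fin k → ℤ) (i : Fin k) : (polyOf k u).coeff i = u i := by
  unfold polyOf
  rw [coeff_add, coeff_X_pow, if_neg (by omega), finsetSum_coeff, zero_add]
  simp only [coeff_C_mul, coeff_X_pow]
  rw [Finset.sum_eq_single i]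
  · simp
  · intro b _ hb
    rw [if_neg (by intro h; exact hb (Fin.ext h.symm)), mul_zero]
  · simp

lemma polyOf_sum_degree (k : ℕ) (u : Fin k → ℤ) :
    (∑ i : Fin k, C (u i) * X ^ (i : ℕ)).degree < (k : WithBot ℕ) := by
  rw [degree_lt_iff_coeff_zero]
  intro j hj
  rw [finsetSum_coeff]
  apply Finset.sum_eq_zero
  intro i _
  rw [coeff_C_mul, coeff_X_pow, if_neg (by omega), mul_zero]

lemma polyOf_monic (k : ℕ) (u : Fin k → ℤ) : (polyOf k u).Monic :=
  monic_X_pow_add (polyOf_sum_degree k u)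

lemma polyOf_natDegree (k : ℕ) (u : Fin k → ℤ) : (polyOf k u).natDegree = k := by
  unfold polyOf
  apply natDegree_eq_of_degree_eq_some
  rw [degree_add_eq_left_of_degree_lt, degree_X_pow]
  rw [degree_X_pow]
  exact polyOf_sum_degree k u

/-- The height of the vector `v`, at least one. -/
def vecHt {k : ℕ} (v : Fin k → ℤ) : ℕ := max 1 (Finset.univ.sup (fun i => (v i).natAbs))

lemma one_le_vecHt {k : ℕ} (v : Fin k → ℤ) : 1 ≤ vecHt v := le_max_left _ _

lemma le_vecHt {k : ℕ} (v : Fin k → ℤ) (i : Fin k) : (v i).natAbs ≤ vecHt v :=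
  le_trans (Finset.le_sup (f := fun i => (v i).natAbs) (Finset.mem_univ i)) (le_max_right _ _)

lemma vecHt_attained {k : ℕ} (v : Fin k → ℤ) :
    ∃ i, vecHt v = ((polyOf k v).coeff i).natAbs := by
  have h1 : ((polyOf k v).coeff k).natAbs = 1 := by
    have := (polyOf_monic k v).coeff_natDegree
    rw [polyOf_natDegree] at this
    rw [this]; rfl
  unfold vecHt
  rcases le_total (Finset.univ.sup (fun i => (v i).natAbs)) 1 with h | h
  · exact ⟨k, by rw [h1, max_eq_left h]⟩
  · rw [max_eq_right h]
    have hne : (Finset.univ : Finset (Fin k)).Nonempty := by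
      by_contra hne
      rw [Finset.not_nonempty_iff_eq_empty] at hne
      rw [hne] at h
      simp at h
    obtain ⟨i, _, hi⟩ := Finset.exists_mem_eq_sup Finset.univ hne (fun i => (v i).natAbs)
    exact ⟨i, by rw [hi, polyOf_coeff]⟩

lemma weight_summable (k : ℕ) (hk : 1 ≤ k) :
    Summable (fun b : ℤ => (max 1 (b.natAbs : ℝ)) ^ (-((k + 1 : ℝ) / k))) := by
  have hk' : (0:ℝ) < k := by exact_mod_cast hk
  have hs := Real.summable_abs_int_rpow (b := (k + 1 : ℝ) / k)
    (by rw [lt_div_iff₀ hk']; linarith)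
  refine (summable_congr_cofinite ?_).2 hs
  rw [Filter.eventuallyEq_iff_exists_mem]
  refine ⟨{0}ᶜ, (Set.finite_singleton 0).compl_mem_cofinite, ?_⟩
  intro b hb
  have hb0 : b ≠ 0 := by simpa using hb
  have : (1:ℝ) ≤ b.natAbs := by exact_mod_cast Int.natAbs_pos.2 hb0
  simp only
  rw [max_eq_right this, Nat.cast_natAbs, Int.cast_abs]

lemma sum_vecHt_bound (k : ℕ) (hk : 1 ≤ k) :
    ∃ S : ℝ, 0 < S ∧ ∀ s : Finset ℤ,
      ∑ v ∈ Fintype.piFinset (fun _ : Fin k => s), ((vecHt v : ℝ) ^ (k + 1))⁻¹ ≤ S := by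
  have hk' : (0:ℝ) < k := by exact_mod_cast hk
  set w : ℤ → ℝ := fun b => (max 1 (b.natAbs : ℝ)) ^ (-((k + 1 : ℝ) / k)) with hw
  have hw0 : ∀ b, 0 ≤ w b := fun b => by positivity
  have hsum : Summable w := weight_summable k hk
  refine ⟨(∑' b, w b) ^ k + 1, by
    have : 0 ≤ ∑' b, w b := tsum_nonneg hw0
    positivity, ?_⟩
  intro s
  calc _ ≤ ∑ v ∈ Fintype.piFinset (fun _ : Fin k => s), ∏ i, w (v i) := by
        apply Finset.sum_le_sum
        intro v _
        have hB : (1:ℝ) ≤ vecHt v := by exact_mod_cast one_le_vecHt v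
        have : ((vecHt v : ℝ) ^ (k + 1))⁻¹ =
            ∏ i : Fin k, (vecHt v : ℝ) ^ (-((k + 1 : ℝ) / k)) := by
          rw [Finset.prod_const, Finset.card_univ, Fintype.card_fin, ← Real.rpow_natCast,
            ← Real.rpow_natCast, ← Real.rpow_mul (by positivity), ← Real.rpow_neg (by positivity)]
          congr 1
          push_cast
          field_simp
        rw [this]
        apply Finset.prod_le_prod
        · intro i _; positivity
        · intro i _
          apply Real.rpow_le_rpow_of_nonpos (by positivity)
          · apply max_le hB
            exact_mod_cast le_vecHt v i
          · rw [neg_nonpos]; positivity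
    _ = ∏ i : Fin k, ∑ b ∈ s, w b := by rw [Finset.prod_univ_sum]
    _ = (∑ b ∈ s, w b) ^ k := by simp
    _ ≤ (∑' b, w b) ^ k := by
        apply pow_le_pow_left₀ (Finset.sum_nonneg (fun b _ => hw0 b))
        exact hsum.sum_le_tsum s (fun b _ => hw0 b)
    _ ≤ _ := by linarith

lemma card_le_sum (m k H K : ℕ) (hm : 2 ≤ m)
    (hK : ∀ g q : ℤ[X], g.Monic → q.Monic → g.natDegree = m → q.natDegree = k →
      HeightLe (g.comp (X * q)) H → ∀ i j, (g.coeff j).natAbs * (q.coeff i).natAbs ^ j ≤ K) :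
    DMonic (m * (k + 1)) m (k + 1) H ≤
      ∑ v ∈ (Fintype.piFinset (fun _ : Fin k => Finset.Icc (-(K:ℤ)) K)).filter
        (fun v => vecHt v ^ m ≤ K), ∏ j : Fin m, (2 * (K / vecHt v ^ (j : ℕ)) + 1) := by
  classical
  set T : Finset (Σ _ : (Fin k → ℤ), (Fin m → ℤ)) :=
    ((Fintype.piFinset (fun _ : Fin k => Finset.Icc (-(K:ℤ)) K)).filter
        (fun v => vecHt v ^ m ≤ K)).sigma
      (fun v => Fintype.piFinset (fun j : Fin m =>
        Finset.Icc (-((K / vecHt v ^ (j : ℕ) : ℕ) : ℤ)) ((K / vecHt v ^ (j : ℕ) : ℕ) : ℤ))) with hT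
  have hcard : T.card = ∑ v ∈ (Fintype.piFinset (fun _ : Fin k => Finset.Icc (-(K:ℤ)) K)).filter
        (fun v => vecHt v ^ m ≤ K), ∏ j : Fin m, (2 * (K / vecHt v ^ (j : ℕ)) + 1) := by
    rw [hT, Finset.card_sigma]
    apply Finset.sum_congr rfl
    intro v _
    rw [Fintype.card_piFinset]
    apply Finset.prod_congr rfl
    intro j _
    rw [Int.card_Icc]
    omega
  rw [← hcard]
  set F : (Σ _ : (Fin k → ℤ), (Fin m → ℤ)) → ℤ[X] :=
    fun t => (polyOf m t.2).comp (X * polyOf k t.1) with hF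
  have hsub : {f : ℤ[X] | f.Monic ∧ f.natDegree = m * (k + 1) ∧ HeightLe f H ∧
      ∃ g h : ℤ[X], g.natDegree = m ∧ h.natDegree = k + 1 ∧ f = g.comp h} ⊆
      ((T.image F : Finset ℤ[X]) : Set ℤ[X]) := by
    rintro f ⟨hf, hfd, hfH, g, h, hg, hh, hfg⟩
    obtain ⟨g', h', hg', hh', hgd, hhd, h0, hfg'⟩ :=
      normalize_decomp m (k+1) (by omega) (by omega) f g h hf hg hh hfg
    obtain ⟨q, rfl⟩ := X_dvd_iff.2 h0
    have hq : q.Monic := by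
      unfold Monic at hh' ⊢
      simpa [leadingCoeff_mul] using hh'
    have hqd : q.natDegree = k := by
      rw [natDegree_X_mul hq.ne_zero] at hhd; omega
    have hb := hK g' q hg' hq hgd hqd (hfg' ▸ hfH)
    set v : Fin k → ℤ := fun i => q.coeff i with hv
    set u : Fin m → ℤ := fun i => g'.coeff i with hu
    have eq1 : q = polyOf k v := eq_polyOf k q hq hqd
    have eq2 : g' = polyOf m u := eq_polyOf m g' hg' hgd
    obtain ⟨i, hi⟩ := vecHt_attained v
    rw [← eq1] at hi
    have hb' : ∀ j, (g'.coeff j).natAbs * vecHt v ^ j ≤ K := fun j => hi ▸ hb i j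
    have hBm : vecHt v ^ m ≤ K := by
      have := hb' m
      rw [← hgd, hg'.coeff_natDegree, hgd] at this
      simpa using this
    have hBK : vecHt v ≤ K := le_trans (Nat.le_self_pow (by omega) _) hBm
    simp only [Finset.coe_image, Set.mem_image, Finset.mem_coe]
    refine ⟨⟨v, u⟩, ?_, ?_⟩
    · rw [hT, Finset.mem_sigma, Finset.mem_filter, Fintype.mem_piFinset, Fintype.mem_piFinset]
      refine ⟨⟨?_, hBm⟩, ?_⟩
      · intro a
        have := le_vecHt v a
        rw [Finset.mem_Icc]
        change -(K:ℤ) ≤ v a ∧ v a ≤ K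
        omega
      · intro j
        have h1 := hb' j
        rw [← Nat.le_div_iff_mul_le (pow_pos (one_le_vecHt v) _)] at h1
        have h2 : u j = g'.coeff j := rfl
        rw [Finset.mem_Icc]
        simp only
        rw [h2]
        omega
    · rw [hF, hfg']
      simp only
      rw [← eq1, ← eq2]
  unfold DMonic
  calc _ ≤ Nat.card ((T.image F : Finset ℤ[X]) : Set ℤ[X]) :=
        Nat.card_mono (Finset.finite_toSet _) hsub
    _ = (T.image F).card := by simp
    _ ≤ T.card := Finset.card_image_le

lemma prod_bound (m k K B : ℕ) (hB : 1 ≤ B) (hBK : B ^ m ≤ K)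
    (hcond : 2 * (k + 1) ≤ m * (m - 1)) :
    ((∏ j : Fin m, (2 * (K / B ^ (j : ℕ)) + 1) : ℕ) : ℝ) ≤
      (3 * K : ℝ) ^ m * ((B : ℝ) ^ (k + 1))⁻¹ := by
  have hB' : (1:ℝ) ≤ B := by exact_mod_cast hB
  have hsum : ∑ j : Fin m, (j : ℕ) = m * (m - 1) / 2 := by
    rw [← Finset.sum_range (fun j => j), Finset.sum_range_id]
  calc _ = ∏ j : Fin m, (2 * ((K / B ^ (j : ℕ) : ℕ) : ℝ) + 1) := by push_cast; rfl
    _ ≤ ∏ j : Fin m, (3 * K * ((B : ℝ) ^ (j : ℕ))⁻¹) := by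
        apply Finset.prod_le_prod
        · intro j _; positivity
        · intro j _
          have h1 : ((K / B ^ (j : ℕ) : ℕ) : ℝ) ≤ K * ((B : ℝ) ^ (j : ℕ))⁻¹ := by
            refine Nat.cast_div_le.trans ?_
            rw [Nat.cast_pow, div_eq_mul_inv]
          have h2 : 1 ≤ K * ((B : ℝ) ^ (j : ℕ))⁻¹ := by
            rw [← div_eq_mul_inv, one_le_div (by positivity)]
            calc (B : ℝ) ^ (j : ℕ) ≤ (B : ℝ) ^ m := pow_le_pow_right₀ hB' j.2.le
              _ ≤ K := by exact_mod_cast hBK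
          linarith
    _ = (3 * K : ℝ) ^ m * ((B : ℝ) ^ (m * (m - 1) / 2))⁻¹ := by
        rw [Finset.prod_mul_distrib, Finset.prod_inv_distrib, Finset.prod_pow_eq_pow_sum, hsum]
        simp
    _ ≤ _ := by
        gcongr
        omega

lemma upper (m k : ℕ) (hm : 2 ≤ m) (hk : 1 ≤ k) (hcond : 2 * (k + 1) ≤ m * (m - 1)) :
    ∃ c : ℝ, 0 < c ∧ ∀ H : ℕ, (DMonic (m * (k + 1)) m (k + 1) H : ℝ) ≤ c * (H : ℝ) ^ m := by
  obtain ⟨S, hS0, hS⟩ := sum_vecHt_bound k hk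
  set A : ℕ := 2 ^ m * (2 ^ (k+1)) ^ m * (m * (k+1) + 1) with hA
  have hA0 : 0 < A := by positivity
  refine ⟨(3 * A : ℝ) ^ m * S, by positivity, ?_⟩
  intro H
  have h1 := card_le_sum m k H (A * H) hm (fun g q hg hq hgm hqk hH i j =>
    key_bound m k H g q hg hq hgm hqk hH i j)
  set s := Fintype.piFinset (fun _ : Fin k => Finset.Icc (-((A * H : ℕ):ℤ)) ((A * H : ℕ) : ℤ))
  calc _ ≤ ∑ v ∈ s.filter (fun v => vecHt v ^ m ≤ A * H),
        ((∏ j : Fin m, (2 * (A * H / vecHt v ^ (j : ℕ)) + 1) : ℕ) : ℝ) := by exact_mod_cast h1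
    _ ≤ ∑ v ∈ s.filter (fun v => vecHt v ^ m ≤ A * H),
        (3 * (A * H : ℕ) : ℝ) ^ m * ((vecHt v : ℝ) ^ (k + 1))⁻¹ := by
      apply Finset.sum_le_sum
      intro v hv
      exact prod_bound m k (A * H) (vecHt v) (one_le_vecHt v) (Finset.mem_filter.1 hv).2 hcond
    _ ≤ ∑ v ∈ s, (3 * (A * H : ℕ) : ℝ) ^ m * ((vecHt v : ℝ) ^ (k + 1))⁻¹ := by
      apply Finset.sum_le_sum_of_subset_of_nonneg (Finset.filter_subset _ _)
      intro v _ _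
      positivity
    _ = (3 * (A * H : ℕ) : ℝ) ^ m * ∑ v ∈ s, ((vecHt v : ℝ) ^ (k + 1))⁻¹ := by
      rw [Finset.mul_sum]
    _ ≤ (3 * (A * H : ℕ) : ℝ) ^ m * S := by gcongr; exact hS _
    _ = _ := by push_cast; ring

lemma heightLe_finite (d H : ℕ) : {f : ℤ[X] | f.Monic ∧ f.natDegree = d ∧ HeightLe f H}.Finite := by
  apply Set.Finite.subset (Set.Finite.image (polyOf d)
    (Fintype.piFinset (fun _ : Fin d => Finset.Icc (-(H:ℤ)) H)).finite_toSet)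
  rintro f ⟨hf, hfd, hfH⟩
  refine ⟨fun i => f.coeff i, ?_, (eq_polyOf d f hf hfd).symm⟩
  simp only [Finset.mem_coe, Fintype.mem_piFinset, Finset.mem_Icc]
  intro i
  exact abs_le.1 (hfH i)

lemma lower (m n H : ℕ) (hn : 2 ≤ n) (hH : 2 ≤ H) :
    H ^ m ≤ DMonic (m * n) m n H := by
  classical
  set U := Fintype.piFinset (fun _ : Fin m => Finset.Icc (-(H:ℤ)) H) with hU
  set F : (Fin m → ℤ) → ℤ[X] := fun u => (polyOf m u).comp (X ^ n) with hF
  have hFe : ∀ u, F u = expand ℤ n (polyOf m u) := fun u => by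
    rw [hF, expand_eq_comp_X_pow]
  have hinj : Function.Injective F := by
    intro u u' h
    rw [hFe, hFe] at h
    have := expand_injective (by omega) h
    ext i
    rw [← polyOf_coeff m u i, this, polyOf_coeff]
  have hcard : (U.image F).card = (2 * H + 1) ^ m := by
    rw [Finset.card_image_of_injective _ hinj, hU, Fintype.card_piFinset]
    simp only [Int.card_Icc, Finset.prod_const, Finset.card_univ, Fintype.card_fin]
    congr 1
    omega
  calc H ^ m ≤ (2 * H + 1) ^ m := Nat.pow_le_pow_left (by omega) m
    _ = (U.image F).card := hcard.symm
    _ = Nat.card ((U.image F : Finset ℤ[X]) : Set ℤ[X]) := by simp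
    _ ≤ _ := by
      unfold DMonic
      apply Nat.card_mono (s := ((U.image F : Finset ℤ[X]) : Set ℤ[X]))
        (t := {f : ℤ[X] | f.Monic ∧ f.natDegree = m * n ∧ HeightLe f H ∧
          ∃ g h : ℤ[X], g.natDegree = m ∧ h.natDegree = n ∧ f = g.comp h})
      · apply (heightLe_finite (m * n) H).subset
        rintro f ⟨h1, h2, h3, _⟩
        exact ⟨h1, h2, h3⟩
      · intro f hf
        simp only [Finset.coe_image, Set.mem_image, Finset.mem_coe] at hf
        obtain ⟨u, hu, rfl⟩ := hf
        rw [hU, Fintype.mem_piFinset] at hu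
        refine ⟨?_, ?_, ?_, polyOf m u, X ^ n, polyOf_natDegree m u, natDegree_X_pow n, rfl⟩
        · rw [hFe]
          exact (polyOf_monic m u).expand (by omega)
        · rw [hFe, natDegree_expand, polyOf_natDegree]
        · intro i
          rw [hFe, coeff_expand (by omega)]
          split_ifs with hd
          · rcases lt_trichotomy (i / n) m with h | h | h
            · have := polyOf_coeff m u ⟨i / n, h⟩
              simp only at this
              rw [this]
              exact abs_le.2 (Finset.mem_Icc.1 (hu _))
            · have := (polyOf_monic m u).coeff_natDegree
              rw [polyOf_natDegree] at this
              rw [h, this]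
              simp
              omega
            · rw [coeff_eq_zero_of_natDegree_lt (by rw [polyOf_natDegree]; exact h)]
              simp
          · simp

theorem stmt_0 (d m n : ℕ) (hd : 4 ≤ d) (hm : 2 ≤ m) (hn : 2 ≤ n) (hmn : d = m * n)
    (hcond : 2 * n ≤ m * (m - 1)) :
    ∃ c₁ c₂ : ℝ, 0 < c₁ ∧ 0 < c₂ ∧ ∀ H : ℕ, 2 ≤ H →
      c₁ * (H : ℝ) ^ m ≤ (DMonic d m n H : ℝ) ∧
      (DMonic d m n H : ℝ) ≤ c₂ * (H : ℝ) ^ m := by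
  subst hmn
  obtain ⟨k, rfl⟩ : ∃ k, n = k + 1 := ⟨n - 1, by omega⟩
  obtain ⟨c, hc, hu⟩ := upper m k hm (by omega) hcond
  refine ⟨1, c, one_pos, hc, fun H hH => ⟨?_, hu H⟩⟩
  rw [one_mul]
  exact_mod_cast lower m (k + 1) H hn hH
end

section
/- Let d ≥ 4 be an integer and let m, n be integers with m ≥ 2, n ≥ 2 and d = mn. If m(m-1) = 2(n-1), then there exists a constant c > 0 (depending only on d) such that for all integers H ≥ 2, D_d(m,n;H) ≤ c·H^m·log H, where log denotes the natural logarithm. -/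
open Polynomial

lemma aux_root (h : ℂ[X]) (n i : ℕ) (hn : h.natDegree = n) (hi : i ≠ 0) (h0 : h.coeff 0 = 0)
    (hne : h.coeff i ≠ 0) (β : ℂ) :
    (C (h.coeff i) * X - C β).mahlerMeasure ≤ 2 ^ n * (h - C β).mahlerMeasure := by
  have key : ∀ k, ‖(h - C β).coeff k‖ ≤ 2 ^ n * (h - C β).mahlerMeasure := by
    intro k
    refine (norm_coeff_le_choose_mul_mahlerMeasure k _).trans ?_
    rw [natDegree_sub_C, hn]
    gcongr
    · exact mahlerMeasure_nonneg _
    · exact_mod_cast Nat.choose_le_two_pow n k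
  rw [sub_eq_add_neg, ← C_neg, mahlerMeasure_C_mul_X_add_C hne]
  apply max_le
  · have := key i
    rwa [coeff_sub, coeff_C_of_ne_zero hi, sub_zero] at this
  · have := key 0
    rwa [coeff_sub, coeff_C_zero, h0, zero_sub] at this

lemma aux_prod (h : ℂ[X]) (n i : ℕ) (hn : h.natDegree = n) (hi : i ≠ 0) (h0 : h.coeff 0 = 0)
    (hne : h.coeff i ≠ 0) (s : Multiset ℂ) :
    ((s.map (fun β => X - C β)).prod.comp (C (h.coeff i) * X)).mahlerMeasure ≤
      (2 ^ n) ^ (s.card) * ((s.map (fun β => X - C β)).prod.comp h).mahlerMeasure := by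
  induction s using Multiset.induction_on with
  | empty => simp
  | cons a s ih =>
    simp only [Multiset.map_cons, Multiset.prod_cons, mul_comp, mahlerMeasure_mul, sub_comp,
      X_comp, C_comp, Multiset.card_cons]
    have h1 := aux_root h n i hn hi h0 hne a
    calc _ ≤ (2 ^ n * (h - C a).mahlerMeasure) * ((2 ^ n) ^ (s.card) *
          ((s.map (fun β => X - C β)).prod.comp h).mahlerMeasure) := by
          apply mul_le_mul h1 ih (mahlerMeasure_nonneg _)
          exact mul_nonneg (by positivity) (mahlerMeasure_nonneg _)
      _ = _ := by ring

lemma aux_bound (g h : ℤ[X]) (m n i H : ℕ) (hg : g.Monic) (hgm : g.natDegree = m)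
    (hn : h.natDegree = n) (hi : i ≠ 0) (h0 : h.coeff 0 = 0)
    (hne : h.coeff i ≠ 0) (hH : HeightLe (g.comp h) H) (k : ℕ) :
    |g.coeff k| * |h.coeff i| ^ k ≤ ((2 ^ m * (2 ^ n) ^ m * (m * n + 1) * H : ℕ) : ℤ) := by
  set φ := Int.castRingHom ℂ
  have hφ : Function.Injective φ := Int.cast_injective
  set G := g.map φ with hG
  set h' := h.map φ with hh'
  have hGmon : G.Monic := hg.map φ
  have hGd : G.natDegree = m := by rw [hG, hg.natDegree_map, hgm]
  have hs := IsAlgClosed.splits G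
  have hGp := hs.eq_prod_roots_of_monic hGmon
  have hcard : G.roots.card = m := by rw [← hs.natDegree_eq_card_roots, hGd]
  have hc : h'.coeff i = ((h.coeff i : ℤ) : ℂ) := by simp [hh', φ]
  have hne' : h'.coeff i ≠ 0 := by rw [hc]; exact_mod_cast hne
  have h1 := aux_prod h' n i (by rw [hh', natDegree_map_eq_of_injective hφ, hn]) hi
    (by simp [hh', h0]) hne' G.roots
  rw [← hGp, hcard] at h1
  have h2 := norm_coeff_le_choose_mul_mahlerMeasure k (G.comp (C (h'.coeff i) * X))
  rw [comp_C_mul_X_coeff, natDegree_comp, natDegree_C_mul_X _ hne', hGd, mul_one] at h2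
  have hF : G.comp h' = (g.comp h).map φ := by rw [Polynomial.map_comp]
  have h3 : (G.comp h').mahlerMeasure ≤ (m * n + 1) * H := by
    refine (mahlerMeasure_le_sum_norm_coeff _).trans ?_
    rw [hF, sum_over_range' _ (by simp) (m * n + 1)]
    · calc _ ≤ ∑ a ∈ Finset.range (m * n + 1), (H : ℝ) := by
            apply Finset.sum_le_sum
            intro a _
            have := hH a
            simp only [coeff_map, φ, eq_intCast, Complex.norm_intCast]
            exact_mod_cast this
        _ = _ := by simp
    · rw [natDegree_map_eq_of_injective hφ, natDegree_comp, hgm, hn]; omega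
  have h4 : ‖G.coeff k * h'.coeff i ^ k‖ = ((|g.coeff k| * |h.coeff i| ^ k : ℤ) : ℝ) := by
    rw [hc, norm_mul, norm_pow, hG]; simp [φ]
  rw [h4] at h2
  have h5 : (m.choose k : ℝ) ≤ 2 ^ m := by exact_mod_cast Nat.choose_le_two_pow m k
  have : ((|g.coeff k| * |h.coeff i| ^ k : ℤ) : ℝ) ≤ 2 ^ m * ((2 ^ n) ^ m * ((m * n + 1) * H)) := by
    refine h2.trans (mul_le_mul h5 (h1.trans ?_) (mahlerMeasure_nonneg _) (by positivity))
    gcongr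
  have h6 : ((|g.coeff k| * |h.coeff i| ^ k : ℤ) : ℝ) ≤
      (((2 ^ m * (2 ^ n) ^ m * (m * n + 1) * H : ℕ) : ℤ) : ℝ) := by
    refine this.trans (le_of_eq ?_); push_cast; ring
  exact_mod_cast h6

lemma aux_norm (f g h : ℤ[X]) (m n : ℕ) (hm : 2 ≤ m) (hn : 2 ≤ n) (hf : f.Monic)
    (hgm : g.natDegree = m) (hhn : h.natDegree = n) (hfg : f = g.comp h) :
    ∃ g' h' : ℤ[X], g'.Monic ∧ h'.Monic ∧ g'.natDegree = m ∧ h'.natDegree = n ∧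
      h'.coeff 0 = 0 ∧ f = g'.comp h' := by
  have hl : g.leadingCoeff * h.leadingCoeff ^ m = 1 := by
    rw [← hgm, ← leadingCoeff_comp (by omega), ← hfg]; exact hf
  have hu : IsUnit h.leadingCoeff := by
    have : IsUnit (h.leadingCoeff ^ m) := IsUnit.of_mul_eq_one_right _ hl
    exact (isUnit_pow_iff (by omega)).1 this
  set u := h.leadingCoeff with hud
  have huu : u * u = 1 := by
    rcases Int.isUnit_iff.1 hu with h | h <;> rw [h] <;> norm_num
  have hu0 : u ≠ 0 := hu.ne_zero
  have hCu : (C u : ℤ[X]) * C u = 1 := by rw [← C_mul, huu, C_1]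
  have hdeg : (C u * h - C (u * h.coeff 0)).natDegree = n := by
    rw [natDegree_sub_C, natDegree_C_mul hu0, hhn]
  have hmon : (C u * h - C (u * h.coeff 0)).Monic := by
    rw [Monic, leadingCoeff, hdeg, coeff_sub, coeff_C_of_ne_zero (by omega), coeff_C_mul, sub_zero,
      ← hhn]
    exact huu
  have hcomp : f = (g.comp (C u * X + C (h.coeff 0))).comp (C u * h - C (u * h.coeff 0)) := by
    rw [comp_assoc, hfg]
    congr 1
    simp only [add_comp, mul_comp, C_comp, X_comp]
    rw [mul_sub, ← mul_assoc, hCu, ← C_mul, ← mul_assoc, huu]; simp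
  refine ⟨g.comp (C u * X + C (h.coeff 0)), C u * h - C (u * h.coeff 0), ?_, hmon, ?_, hdeg, ?_,
    hcomp⟩
  · have h1 := hf
    rw [Monic, hcomp, leadingCoeff_comp (by omega), hmon.leadingCoeff, one_pow, mul_one] at h1
    exact h1
  · rw [natDegree_comp, natDegree_linear hu0, hgm, mul_one]
  · simp

/-- polynomials built from coefficient vectors -/
noncomputable def buildPoly (m n : ℕ) (p : (Fin n → ℤ) × (Fin m → ℤ)) : ℤ[X] :=
  (X ^ m + ∑ k : Fin m, C (p.2 k) * X ^ (k : ℕ)).comp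
    (X ^ (n + 1) + ∑ k : Fin n, C (p.1 k) * X ^ ((k : ℕ) + 1))

/-- The box of coefficient vectors at dyadic scale `j`. -/
noncomputable def boxes (m n N j : ℕ) : Finset ((Fin n → ℤ) × (Fin m → ℤ)) :=
  (Fintype.piFinset fun _ : Fin n => Finset.Icc (-(2 ^ (j + 1) : ℤ)) (2 ^ (j + 1))) ×ˢ
  (Fintype.piFinset fun k : Fin m =>
    Finset.Icc (-((N / 2 ^ (j * k) : ℕ) : ℤ)) ((N / 2 ^ (j * k) : ℕ) : ℤ))

lemma boxes_card (m n N j : ℕ) (hc : m * (m - 1) = 2 * n) (hj : 2 ^ (j * m) ≤ N) :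
    (boxes m n N j).card ≤ 5 ^ n * (3 * N) ^ m := by
  have h1 : (boxes m n N j).card =
      (2 * 2 ^ (j + 1) + 1) ^ n * ∏ k : Fin m, (2 * (N / 2 ^ (j * k)) + 1) := by
    rw [boxes, Finset.card_product, Fintype.card_piFinset, Fintype.card_piFinset]
    congr 1
    · rw [Finset.prod_const, Finset.card_univ, Fintype.card_fin, Int.card_Icc]
      congr 1
      have : ((2 : ℤ) ^ (j + 1)) = ((2 ^ (j + 1) : ℕ) : ℤ) := by push_cast; rfl
      rw [this]; omega
    · refine Finset.prod_congr rfl fun k _ => ?_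
      rw [Int.card_Icc]; omega
  have h2 : (2 * 2 ^ (j + 1) + 1) ^ n ≤ 5 ^ n * 2 ^ (j * n) := by
    rw [pow_mul, ← mul_pow]
    apply Nat.pow_le_pow_left
    have := Nat.one_le_two_pow (n := j)
    rw [pow_succ]; omega
  have h3 : (∏ k : Fin m, (2 * (N / 2 ^ (j * k)) + 1)) * 2 ^ (j * n) ≤ (3 * N) ^ m := by
    have : 2 ^ (j * n) = ∏ k : Fin m, 2 ^ (j * (k : ℕ)) := by
      rw [Finset.prod_pow_eq_pow_sum, ← Finset.mul_sum, Fin.sum_univ_eq_sum_range (fun k => k) m]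
      have := Finset.sum_range_id_mul_two m
      congr 2; omega
    rw [this, ← Finset.prod_mul_distrib]
    calc _ ≤ ∏ k : Fin m, 3 * N := by
          refine Finset.prod_le_prod' fun k _ => ?_
          have h5 : 2 ^ (j * (k : ℕ)) ≤ N :=
            (Nat.pow_le_pow_right (by norm_num) (Nat.mul_le_mul_left _ k.2.le)).trans hj
          have h6 := Nat.div_mul_le_self N (2 ^ (j * (k : ℕ)))
          nlinarith
      _ = _ := by simp
  rw [h1]
  calc _ ≤ 5 ^ n * 2 ^ (j * n) * ∏ k : Fin m, (2 * (N / 2 ^ (j * k)) + 1) := by gcongr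
    _ = 5 ^ n * ((∏ k : Fin m, (2 * (N / 2 ^ (j * k)) + 1)) * 2 ^ (j * n)) := by ring
    _ ≤ _ := by gcongr

lemma monic_sum (p : ℤ[X]) (hp : p.Monic) (m : ℕ) (hm : p.natDegree = m) :
    p = X ^ m + ∑ k : Fin m, C (p.coeff k) * X ^ (k : ℕ) := by
  rw [Fin.sum_univ_eq_sum_range (fun k => C (p.coeff k) * X ^ k) m, ← hm]
  exact hp.as_sum

lemma mem_boxes (f : ℤ[X]) (m n H N : ℕ) (hm : 2 ≤ m) (hn : 1 ≤ n)
    (hN : N = 2 ^ m * (2 ^ (n + 1)) ^ m * (m * (n + 1) + 1) * H) (hf : f.Monic)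
    (hH : HeightLe f H)
    (hex : ∃ g h : ℤ[X], g.natDegree = m ∧ h.natDegree = n + 1 ∧ f = g.comp h) :
    ∃ j, 2 ^ (j * m) ≤ N ∧ ∃ p ∈ boxes m n N j, buildPoly m n p = f := by
  obtain ⟨g0, h0, hg0, hh0, hf0⟩ := hex
  obtain ⟨g, h, hg, hh, hgm, hhn, hz, hfg⟩ := aux_norm f g0 h0 m (n + 1) hm (by omega) hf hg0 hh0 hf0
  obtain ⟨i, hi, himax⟩ := Finset.exists_max_image (Finset.range (n + 2)) (fun i => (h.coeff i).natAbs)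
    ⟨0, by simp⟩
  have h1 : 1 ≤ (h.coeff i).natAbs := by
    have := himax (n + 1) (by simp)
    have h2 : h.coeff (n + 1) = 1 := by rw [← hhn]; exact hh
    rw [h2] at this; simpa using this
  have hne : h.coeff i ≠ 0 := by intro h; rw [h] at h1; simp at h1
  have hi0 : i ≠ 0 := by rintro rfl; exact hne hz
  rw [hfg] at hH
  have hb := aux_bound g h m (n + 1) i H hg hgm hhn hi0 hz hne hH
  rw [← hN] at hb
  set L := (h.coeff i).natAbs with hL
  set j := Nat.log 2 L with hj
  have hj1 : 2 ^ j ≤ L := Nat.pow_log_le_self 2 (by omega)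
  have hj2 : L < 2 ^ (j + 1) := Nat.lt_pow_succ_log_self (by norm_num) L
  have hb' : ∀ k, (g.coeff k).natAbs * 2 ^ (j * k) ≤ N := by
    intro k
    have h3 : (g.coeff k).natAbs * L ^ k ≤ N := by
      zify; rw [hL, Int.natCast_natAbs]; exact hb k
    refine le_trans ?_ h3
    rw [pow_mul]
    gcongr
  refine ⟨j, ?_, (fun k => h.coeff (k + 1), fun k => g.coeff k), ?_, ?_⟩
  · have := hb' m
    rw [← hgm, coeff_natDegree, hg.leadingCoeff] at this
    rw [← hgm]; simpa using this
  · simp only [boxes, Finset.mem_product, Fintype.mem_piFinset, Finset.mem_Icc]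
    constructor
    · intro k
      have h4 := himax (k + 1) (by simp)
      have h5 : (h.coeff (k + 1)).natAbs ≤ 2 ^ (j + 1) := h4.trans hj2.le
      have : ((2 : ℤ) ^ (j + 1)) = ((2 ^ (j + 1) : ℕ) : ℤ) := by push_cast; rfl
      rw [this]; omega
    · intro k
      have : (g.coeff k).natAbs ≤ N / 2 ^ (j * (k : ℕ)) :=
        (Nat.le_div_iff_mul_le (by positivity)).2 (hb' k)
      omega
  · rw [buildPoly, hfg]
    congr 1
    · exact (monic_sum g hg m hgm).symm
    · conv_rhs => rw [monic_sum h hh (n + 1) hhn, Fin.sum_univ_succ]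
      simp [hz]

lemma card_bound (d m n H N : ℕ) (hm : 2 ≤ m) (hn : 1 ≤ n) (hc : m * (m - 1) = 2 * n)
    (hN : N = 2 ^ m * (2 ^ (n + 1)) ^ m * (m * (n + 1) + 1) * H) :
    DMonic d m (n + 1) H ≤ (Nat.log 2 N + 1) * (5 ^ n * (3 * N) ^ m) := by
  classical
  set J := (Finset.range (Nat.log 2 N + 1)).filter (fun j => 2 ^ (j * m) ≤ N) with hJ
  set T : Finset ℤ[X] := J.biUnion fun j => (boxes m n N j).image (buildPoly m n) with hT
  have hT1 : T.card ≤ (Nat.log 2 N + 1) * (5 ^ n * (3 * N) ^ m) := by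
    refine (Finset.card_biUnion_le_card_mul _ _ (5 ^ n * (3 * N) ^ m) ?_).trans ?_
    · intro j hj
      exact Finset.card_image_le.trans (boxes_card m n N j hc (Finset.mem_filter.1 hj).2)
    · gcongr
      exact (Finset.card_filter_le _ _).trans (by simp)
  refine le_trans ?_ hT1
  rw [DMonic, ← Set.ncard_coe_finset T]
  refine Set.ncard_le_ncard (s := {f : ℤ[X] | f.Monic ∧ f.natDegree = d ∧ HeightLe f H ∧
    ∃ g h : ℤ[X], g.natDegree = m ∧ h.natDegree = n + 1 ∧ f = g.comp h}) ?_ T.finite_toSet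
  rintro f ⟨hf, -, hH, hex⟩
  obtain ⟨j, hj, p, hp, rfl⟩ := mem_boxes f m n H N hm hn hN hf hH hex
  simp only [hT, Finset.coe_biUnion, Set.mem_iUnion, Finset.mem_coe, Finset.mem_image]
  refine ⟨j, ?_, p, hp, rfl⟩
  rw [hJ, Finset.mem_filter, Finset.mem_range]
  refine ⟨Nat.lt_succ_of_le (Nat.le_log_of_pow_le (by norm_num) ?_), hj⟩
  refine le_trans (Nat.pow_le_pow_right (by norm_num) ?_) hj
  exact Nat.le_mul_of_pos_right _ (by omega)

theorem stmt_2 (d m n : ℕ) (hd : 4 ≤ d) (hm : 2 ≤ m) (hn : 2 ≤ n) (hmn : d = m * n)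
    (hcond : m * (m - 1) = 2 * (n - 1)) :
    ∃ c : ℝ, 0 < c ∧ ∀ H : ℕ, 2 ≤ H →
      (DMonic d m n H : ℝ) ≤ c * (H : ℝ) ^ m * Real.log H := by
  obtain ⟨n, rfl⟩ : ∃ k, n = k + 1 := ⟨n - 1, by omega⟩
  simp only [Nat.add_sub_cancel] at hcond
  set K : ℕ := 2 ^ m * (2 ^ (n + 1)) ^ m * (m * (n + 1) + 1) with hK
  have hK1 : 1 ≤ K := Nat.one_le_iff_ne_zero.2 (by positivity)
  have hl2 : 0 < Real.log 2 := Real.log_pos (by norm_num)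
  have hlK : 0 ≤ Real.log K := Real.log_natCast_nonneg K
  set A : ℝ := (Real.log K / Real.log 2 + 2) / Real.log 2 with hA
  have hA0 : 0 < A := by positivity
  refine ⟨A * (5 ^ n * (3 * K) ^ m), by positivity, fun H hH => ?_⟩
  have h1 := card_bound d m n H (K * H) hm (by omega) hcond rfl
  have h1' : (DMonic d m (n + 1) H : ℝ) ≤
      ((Nat.log 2 (K * H) : ℝ) + 1) * (5 ^ n * (3 * (K * H)) ^ m) := by exact_mod_cast h1
  have hlH : Real.log 2 ≤ Real.log H := Real.log_le_log (by norm_num) (by exact_mod_cast hH)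
  have h2 : (Nat.log 2 (K * H) : ℝ) ≤ (Real.log K + Real.log H) / Real.log 2 := by
    have := Real.natLog_le_logb (K * H) 2
    rw [Real.logb, Nat.cast_mul, Real.log_mul (by positivity) (by positivity)] at this
    exact_mod_cast this
  have h3 : (Nat.log 2 (K * H) : ℝ) + 1 ≤ A * Real.log H := by
    have e : A * Real.log H = (Real.log K * (Real.log H / Real.log 2) + Real.log H + Real.log H) / Real.log 2 := by
      rw [hA]; field_simp; ring
    have h4 : 1 ≤ Real.log H / Real.log 2 := (one_le_div hl2).2 hlH
    have h5 : (Nat.log 2 (K * H) : ℝ) + 1 ≤ (Real.log K + Real.log H + Real.log 2) / Real.log 2 := by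
      rw [add_div _ (Real.log 2), div_self hl2.ne']; linarith
    rw [e]
    refine h5.trans ?_
    gcongr
    nlinarith
  calc (DMonic d m (n + 1) H : ℝ) ≤ _ := h1'
    _ ≤ (A * Real.log H) * (5 ^ n * (3 * (K * H)) ^ m) := by gcongr
    _ = _ := by rw [← mul_assoc 3, mul_pow]; ring
end

section
/- There exists a constant c > 0 such that for all integers H ≥ 2, |D_6(H) - I_6(H)| ≤ c·H^{5/2}, where D_6(H) is the number of decomposable monic polynomials in ℤ[x] of degree 6 and height at most H, and I_6(H) is the number of monic polynomials f ∈ ℤ[x] of degree 6 and height at most H such that f = g∘h for some indecomposable polynomials g, h ∈ ℤ[x] with deg g = 3 and deg h = 2. -/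
open Polynomial

/-- A polynomial is decomposable if it is a composition of two polynomials of degree `≥ 2`. -/
def Decomposable (f : ℤ[X]) : Prop :=
  ∃ g h : ℤ[X], 2 ≤ g.natDegree ∧ 2 ≤ h.natDegree ∧ f = g.comp h

/-- `DdMonic d H` is the number of decomposable monic integer polynomials of degree `d`
and height at most `H`. -/
noncomputable def DdMonic (d : ℕ) (H : ℕ) : ℕ :=
  Nat.card {f : ℤ[X] // f.Monic ∧ f.natDegree = d ∧ HeightLe f H ∧ Decomposable f}

/-- `IdMonic d e H` is the number of monic integer polynomials of degree `d` and height at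
most `H` which are compositions `g ∘ h` of indecomposable polynomials with
`deg g = d / e` and `deg h = e`. -/
noncomputable def IdMonic (d e : ℕ) (H : ℕ) : ℕ :=
  Nat.card {f : ℤ[X] // f.Monic ∧ f.natDegree = d ∧ HeightLe f H ∧
    ∃ g h : ℤ[X], ¬ Decomposable g ∧ ¬ Decomposable h ∧
      g.natDegree = d / e ∧ h.natDegree = e ∧ f = g.comp h}

/-- The basic set of triples `(x, y, z)`. -/
noncomputable def baseA (H s : ℕ) : Finset (ℤ × ℤ × ℤ) :=
  (Finset.Icc (-(s : ℤ)) s).biUnion fun y =>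
    (Finset.Icc (-|y|) |y|) ×ˢ (({y} : Finset ℤ) ×ˢ
      (Finset.Icc (-(2 * (H : ℤ) / max |y| 1)) (2 * (H : ℤ) / max |y| 1)))

lemma mem_baseA {H s : ℕ} {x y z : ℤ} (hy : |y| ≤ s) (hx : |x| ≤ |y|)
    (hz : |z| * max |y| 1 ≤ 2 * H) : (x, y, z) ∈ baseA H s := by
  unfold baseA
  simp only [Finset.mem_biUnion, Finset.mem_product, Finset.mem_Icc, Finset.mem_singleton]
  have h1 := abs_le.1 hx
  have hpos : 0 < max |y| 1 := lt_of_lt_of_le one_pos (le_max_right _ _)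
  have h2 : |z| ≤ 2 * (H : ℤ) / max |y| 1 := (Int.le_ediv_iff_mul_le hpos).2 hz
  exact ⟨y, abs_le.1 hy, h1, rfl, abs_le.1 h2⟩

lemma card_baseA {H s : ℕ} (hs : s ≤ 2 * H) (hH : 1 ≤ H) :
    (baseA H s).card ≤ (2 * s + 1) * (18 * H) := by
  unfold baseA
  refine (Finset.card_biUnion_le_card_mul _ _ (18 * H) ?_).trans ?_
  · intro y hy
    rw [Finset.mem_Icc] at hy
    have hys : |y| ≤ s := abs_le.2 hy
    simp only [Finset.card_product, Int.card_Icc, Finset.card_singleton, one_mul]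
    have hy0 : 0 ≤ |y| := abs_nonneg y
    generalize hm : |y| = m at *
    set M := max m 1 with hM
    have hM1 : 1 ≤ M := le_max_right _ _
    have hMm : m ≤ M := le_max_left _ _
    have hMH : M ≤ 2 * H := by
      apply max_le <;> omega
    have hk1 : 1 ≤ 2 * (H : ℤ) / M := (Int.le_ediv_iff_mul_le (by omega)).2 (by omega)
    have hk2 : 2 * (H : ℤ) / M * M ≤ 2 * H := Int.ediv_mul_le _ (by omega)
    generalize 2 * (H : ℤ) / M = k at *
    zify
    rw [Int.toNat_of_nonneg (by omega), Int.toNat_of_nonneg (by omega)]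
    have e1 : m + 1 - -m ≤ 3 * M := by omega
    have e2 : k + 1 - -k ≤ 3 * k := by omega
    calc (m + 1 - -m) * (k + 1 - -k) ≤ (3 * M) * (3 * k) := by
          apply mul_le_mul e1 e2 <;> omega
      _ = 9 * (k * M) := by ring
      _ ≤ 18 * H := by omega
  · apply Nat.mul_le_mul_right
    rw [Int.card_Icc]; omega

/-- All the triples `(a, b, p)`. -/
noncomputable def baseT (H s : ℕ) : Finset (ℤ × ℤ × ℤ) :=
  (baseA H s ∪ (baseA H s).image fun t => (t.2.1, t.1, t.2.2)) ∪
  ((baseA H s).image (fun t => (t.2.1, t.2.2, t.1)) ∪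
    (baseA H s).image fun t => (t.1, t.2.2, t.2.1))

lemma card_baseT (H s : ℕ) : (baseT H s).card ≤ 4 * (baseA H s).card := by
  unfold baseT
  have h1 := Finset.card_image_le (s := baseA H s) (f := fun t => (t.2.1, t.1, t.2.2))
  have h2 := Finset.card_image_le (s := baseA H s) (f := fun t => (t.2.1, t.2.2, t.1))
  have h3 := Finset.card_image_le (s := baseA H s) (f := fun t => (t.1, t.2.2, t.2.1))
  refine (Finset.card_union_le _ _).trans ?_
  have h4 := Finset.card_union_le (baseA H s)
    ((baseA H s).image fun t => (t.2.1, t.1, t.2.2))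
  have h5 := Finset.card_union_le ((baseA H s).image (fun t => (t.2.1, t.2.2, t.1)))
    ((baseA H s).image fun t => (t.1, t.2.2, t.2.1))
  omega

lemma mem_baseT {H s : ℕ} (hs : (H : ℤ) < (s : ℤ) ^ 2) (hr : ((s : ℤ) - 1) ^ 2 ≤ H)
    (hs1 : 1 ≤ s) {a b p : ℤ}
    (c4 : |a ^ 2 + 2 * b| ≤ (H : ℤ)) (c3 : |2 * a * b + p| ≤ (H : ℤ))
    (c2 : |b ^ 2 + p * a| ≤ (H : ℤ)) (c1 : |p * b| ≤ (H : ℤ)) : (a, b, p) ∈ baseT H s := by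
  have hs0 : (1 : ℤ) ≤ s := by exact_mod_cast hs1
  have ha0 := abs_nonneg a
  have hb0 := abs_nonneg b
  have hp0 := abs_nonneg p
  have c1' : |p| * |b| ≤ H := by rwa [← abs_mul]
  unfold baseT
  simp only [Finset.mem_union, Finset.mem_image, Prod.exists, Prod.mk.injEq]
  by_cases hb : |b| < s
  · left
    have hasq : |a| ≤ s := by
      have := (abs_le.1 c4).2
      have h2 : -|b| ≤ b := neg_abs_le b
      have h3 : |a| ^ 2 < ((s : ℤ) + 1) ^ 2 := by rw [sq_abs]; nlinarith
      have := lt_of_pow_lt_pow_left₀ 2 (by omega) h3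
      omega
    have hbsq : b ^ 2 ≤ H := by
      have : |b| ^ 2 ≤ ((s : ℤ) - 1) ^ 2 := pow_le_pow_left₀ hb0 (by omega) 2
      rw [sq_abs] at this; linarith
    have hpa : |p| * |a| ≤ 2 * H := by
      rw [← abs_mul]
      have := abs_le.1 c2
      have := sq_nonneg b
      apply abs_le.2; constructor <;> linarith
    have hpp : a = 0 → b = 0 → |p| ≤ H := by
      rintro rfl rfl; simpa using c3
    rcases le_or_gt |a| |b| with hab | hab
    · left
      apply mem_baseA hb.le hab
      rcases eq_or_ne b 0 with h0 | h0
      · have : a = 0 := by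
          rw [h0, abs_zero] at hab; exact abs_nonpos_iff.1 hab
        have := hpp this h0
        simp [h0]; linarith
      · have : 1 ≤ |b| := Int.one_le_abs h0
        rw [max_eq_left this]; linarith
    · right
      refine ⟨b, a, p, mem_baseA hasq hab.le ?_, rfl, rfl, rfl⟩
      rw [max_eq_left (by omega)]; exact hpa
  · right
    push Not at hb
    have hpH : |p| ≤ H := by nlinarith
    have hps : |p| < s := by
      by_contra hcon
      push Not at hcon
      nlinarith
    have hab : |a| * |b| ≤ H := by
      rw [← abs_mul]
      have h1 := abs_le.1 c3
      have h2 := abs_le.1 hpH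
      apply abs_le.2; constructor <;> linarith
    have has : |a| < s := by
      by_contra hcon
      push Not at hcon
      nlinarith
    have hbb : a = 0 → |b| ≤ H := by
      rintro rfl
      have h2 := abs_le.1 c4
      apply abs_le.2
      constructor <;> linarith [h2.1, h2.2]
    rcases le_or_gt |p| |a| with h | h
    · left
      refine ⟨p, a, b, mem_baseA has.le h ?_, rfl, rfl, rfl⟩
      rcases eq_or_ne a 0 with h0 | h0
      · have := hbb h0
        simp [h0]; linarith
      · have : 1 ≤ |a| := Int.one_le_abs h0
        rw [max_eq_left this]; linarith
    · right
      refine ⟨a, p, b, mem_baseA hps.le h.le ?_, rfl, rfl, rfl⟩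
      rw [max_eq_left (by omega)]; linarith

/-- The composition of `X^2 + pX + q` with `X^3 + aX^2 + bX`. -/
noncomputable def compF (t : (ℤ × ℤ × ℤ) × ℤ) : ℤ[X] :=
  (X ^ 3 + C t.1.1 * X ^ 2 + C t.1.2.1 * X) ^ 2 +
    C t.1.2.2 * (X ^ 3 + C t.1.1 * X ^ 2 + C t.1.2.1 * X) + C t.2

lemma compF_expand (a b p q : ℤ) : compF ((a, b, p), q) =
    X ^ 6 + C (2 * a) * X ^ 5 + C (a ^ 2 + 2 * b) * X ^ 4 + C (2 * a * b + p) * X ^ 3 +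
      C (b ^ 2 + p * a) * X ^ 2 + C (p * b) * X ^ 1 + C q := by
  simp only [compF, map_add, map_mul, map_pow, map_ofNat]
  ring

lemma compF_mem {H s : ℕ} (hs : (H : ℤ) < (s : ℤ) ^ 2) (hr : ((s : ℤ) - 1) ^ 2 ≤ H)
    (hs1 : 1 ≤ s) {a b p q : ℤ} (h : HeightLe (compF ((a, b, p), q)) H) :
    ((a, b, p), q) ∈ baseT H s ×ˢ Finset.Icc (-(H : ℤ)) H := by
  rw [compF_expand] at h
  have c4 := h 4
  have c3 := h 3
  have c2 := h 2
  have c1 := h 1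
  have c0 := h 0
  simp only [coeff_add, coeff_C_mul, coeff_X_pow, coeff_C] at c4 c3 c2 c1 c0
  norm_num at c4 c3 c2 c1 c0
  rw [← abs_mul] at c1
  rw [Finset.mem_product, Finset.mem_Icc]
  exact ⟨mem_baseT hs hr hs1 c4 c3 c2 c1, abs_le.1 c0⟩

lemma exists_compF {g h : ℤ[X]} (hg : g.natDegree = 2) (hh : h.natDegree = 3)
    (hm : (g.comp h).Monic) : ∃ t, g.comp h = compF t := by
  have hlead : g.coeff 2 * h.coeff 3 ^ 2 = 1 := by
    have := hm.leadingCoeff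
    rw [leadingCoeff_comp (by omega)] at this
    simpa [leadingCoeff, hg, hh] using this
  have hge := g.as_sum_range
  have hhe := h.as_sum_range
  rw [hg] at hge
  rw [hh] at hhe
  simp only [Finset.sum_range_succ, Finset.sum_range_zero, ← C_mul_X_pow_eq_monomial] at hge hhe
  generalize g.coeff 0 = g0 at *
  generalize g.coeff 1 = g1 at *
  generalize g.coeff 2 = g2 at *
  generalize h.coeff 0 = h0 at *
  generalize h.coeff 1 = h1 at *
  generalize h.coeff 2 = h2 at *
  generalize h.coeff 3 = e at *
  have he : e ^ 2 = 1 := by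
    have hu : IsUnit (e ^ 2) := IsUnit.of_mul_eq_one g2 (by rw [mul_comm]; exact hlead)
    rcases Int.isUnit_iff.1 hu with h | h
    · exact h
    · nlinarith [sq_nonneg e]
  have hg2 : g2 = 1 := by rw [he] at hlead; simpa using hlead
  subst hg2
  have heC : (C e : ℤ[X]) ^ 2 = 1 := by rw [← map_pow, he, map_one]
  refine ⟨((e * h2, e * h1, e * (2 * h0 + g1)), h0 ^ 2 + g1 * h0 + g0), ?_⟩
  have hcomp : g.comp h = C g0 + C g1 * h + h ^ 2 := by
    rw [hge]; simp
  rw [hcomp, hhe]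
  simp only [compF, map_add, map_mul, map_pow, map_ofNat]
  have key : ∀ E A B h0 g1 g0 x : ℤ[X], E ^ 2 = 1 →
      g0 + g1 * (h0 + B * x + A * x ^ 2 + E * x ^ 3) +
        (h0 + B * x + A * x ^ 2 + E * x ^ 3) ^ 2 =
      (x ^ 3 + E * A * x ^ 2 + E * B * x) ^ 2 +
        E * (2 * h0 + g1) * (x ^ 3 + E * A * x ^ 2 + E * B * x) +
        (h0 ^ 2 + g1 * h0 + g0) := by
    intro E A B h0 g1 g0 x hE
    linear_combination (-(-(x ^ 3 + E * A * x ^ 2 + E * B * x) ^ 2 +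
      2 * E * (x ^ 3 + E * A * x ^ 2 + E * B * x) * (A * x ^ 2 + B * x) +
      (1 - E ^ 2) * (A * x ^ 2 + B * x) ^ 2 + (2 * h0 + g1) * (A * x ^ 2 + B * x))) * hE
  have := key (C e) (C h2) (C h1) (C h0) (C g1) (C g0) X heC
  rw [← this]
  ring

lemma not_decomposable_of_prime {f : ℤ[X]} (hf : f.natDegree.Prime) : ¬ Decomposable f := by
  rintro ⟨g, h, hg, hh, rfl⟩
  rw [natDegree_comp] at hf
  exact Nat.not_prime_mul (by omega) (by omega) hf

theorem stmt_6 :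
    ∃ c : ℝ, 0 < c ∧ ∀ H : ℕ, 2 ≤ H →
      |(DdMonic 6 H : ℝ) - (IdMonic 6 2 H : ℝ)| ≤ c * (H : ℝ) ^ ((5 : ℝ) / 2) := by
  refine ⟨1296, by norm_num, fun H hH => ?_⟩
  set D : Set ℤ[X] := {f | f.Monic ∧ f.natDegree = 6 ∧ HeightLe f H ∧ Decomposable f} with hD
  set I : Set ℤ[X] := {f | f.Monic ∧ f.natDegree = 6 ∧ HeightLe f H ∧
    ∃ g h : ℤ[X], ¬ Decomposable g ∧ ¬ Decomposable h ∧
      g.natDegree = 6 / 2 ∧ h.natDegree = 2 ∧ f = g.comp h} with hI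
  have e1 : DdMonic 6 H = D.ncard := rfl
  have e2 : IdMonic 6 2 H = I.ncard := rfl
  set s := Nat.sqrt H + 1 with hs
  have hs1 : (H : ℤ) < (s : ℤ) ^ 2 := by
    have := Nat.lt_succ_sqrt' H
    exact_mod_cast this
  have hs2 : ((s : ℤ) - 1) ^ 2 ≤ H := by
    have := Nat.sqrt_le' H
    rw [hs]; push_cast; simp only [add_sub_cancel_right]
    exact_mod_cast this
  set E : Finset ℤ[X] := (baseT H s ×ˢ Finset.Icc (-(H : ℤ)) H).image compF with hE
  have hIfin : I.Finite := by
    refine Set.Finite.of_injOn (f := fun (p : ℤ[X]) (i : Fin 7) => p.coeff i)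
      (t := Set.Icc (fun _ => -(H : ℤ)) (fun _ => (H : ℤ))) ?_ ?_ (Set.finite_Icc _ _)
    · rintro f ⟨-, -, h3, -⟩
      exact ⟨fun i => (abs_le.1 (h3 i)).1, fun i => (abs_le.1 (h3 i)).2⟩
    · rintro f ⟨-, hf, -⟩ g ⟨-, hg, -⟩ hfg
      ext i
      by_cases hi : i < 7
      · exact congrFun hfg ⟨i, hi⟩
      · rw [coeff_eq_zero_of_natDegree_lt (by omega), coeff_eq_zero_of_natDegree_lt (by omega)]
  have hID : I ⊆ D := by
    rintro f ⟨h1, h2, h3, g, h, -, -, h4, h5, h6⟩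
    exact ⟨h1, h2, h3, g, h, by omega, by omega, h6⟩
  have hDE : D ⊆ I ∪ E := by
    rintro f ⟨h1, h2, h3, g, h, h4, h5, h6⟩
    have hdeg : g.natDegree * h.natDegree = 6 := by rw [← natDegree_comp, ← h6, h2]
    have hg3 : g.natDegree ≤ 3 := by nlinarith
    have hcase : g.natDegree = 2 ∨ g.natDegree = 3 := by omega
    rcases hcase with hc | hc
    · right
      have hh : h.natDegree = 3 := by rw [hc] at hdeg; omega
      obtain ⟨⟨⟨a, b, p⟩, q⟩, ht⟩ := exists_compF hc hh (h6 ▸ h1)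
      rw [hE, Finset.coe_image]
      refine ⟨((a, b, p), q), ?_, by rw [h6, ht]⟩
      exact compF_mem hs1 hs2 (by omega) (by rw [← ht, ← h6]; exact h3)
    · left
      have hh : h.natDegree = 2 := by rw [hc] at hdeg; omega
      exact ⟨h1, h2, h3, g, h, not_decomposable_of_prime (by rw [hc]; norm_num),
        not_decomposable_of_prime (by rw [hh]; norm_num), hc, hh, h6⟩
  have hfin : (I ∪ (E : Set ℤ[X])).Finite := hIfin.union E.finite_toSet
  have n1 : I.ncard ≤ D.ncard := Set.ncard_le_ncard hID (hfin.subset hDE)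
  have n2 : D.ncard ≤ I.ncard + E.card := by
    rw [← Set.ncard_coe_finset E]
    exact (Set.ncard_le_ncard hDE hfin).trans (Set.ncard_union_le _ _)
  have hsH : Nat.sqrt H ≤ H := Nat.sqrt_le_self H
  have hs0 : 1 ≤ Nat.sqrt H := Nat.sqrt_pos.2 (by omega)
  have n3 : E.card ≤ 1296 * H ^ 2 * Nat.sqrt H := by
    calc E.card ≤ (baseT H s ×ˢ Finset.Icc (-(H : ℤ)) H).card := Finset.card_image_le
      _ = (baseT H s).card * (2 * H + 1) := by
        rw [Finset.card_product, Int.card_Icc]; congr 1; omega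
      _ ≤ (4 * ((2 * s + 1) * (18 * H))) * (3 * H) := by
        apply Nat.mul_le_mul
        · exact (card_baseT H s).trans (Nat.mul_le_mul_left _ (card_baseA (by omega) (by omega)))
        · omega
      _ ≤ (4 * ((6 * Nat.sqrt H) * (18 * H))) * (3 * H) := by
        gcongr; omega
      _ = 1296 * H ^ 2 * Nat.sqrt H := by ring
  rw [e1, e2]
  have n1' : (I.ncard : ℝ) ≤ D.ncard := by exact_mod_cast n1
  have n2' : (D.ncard : ℝ) ≤ I.ncard + 1296 * H ^ 2 * Nat.sqrt H := by
    exact_mod_cast n2.trans (Nat.add_le_add_left n3 _)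
  have hsq : (Nat.sqrt H : ℝ) ≤ Real.sqrt H := Real.nat_sqrt_le_real_sqrt
  have hpow : (H : ℝ) ^ ((5 : ℝ) / 2) = H ^ 2 * Real.sqrt H := by
    have hH0 : (0 : ℝ) < H := by exact_mod_cast (by omega : 0 < H)
    rw [Real.sqrt_eq_rpow, ← Real.rpow_natCast, ← Real.rpow_add hH0]
    norm_num
  rw [abs_of_nonneg (by linarith), hpow]
  have : (1296 * H ^ 2 * Nat.sqrt H : ℝ) ≤ 1296 * (H ^ 2 * Real.sqrt H) := by
    rw [mul_assoc]; gcongr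
  linarith
end

section
/- Let d ≥ 4 be an integer and let m, n be integers with m ≥ 2, n ≥ 2 and d = mn. If m(m+1) ≥ 2(n+1), then D*_d(m,n;H) ≍ H^{m+1}, i.e. there exist constants c₁, c₂ > 0 (depending only on d) such that for all integers H ≥ 2, c₁·H^{m+1} ≤ D*_d(m,n;H) ≤ c₂·H^{m+1}. -/
open Polynomial

/-- `DStar d m n H` is the number of integer polynomials (not necessarily monic) of
degree `d` and height at most `H` that are a composition `g ∘ h` with `deg g = m`,
`deg h = n`. -/
noncomputable def DStar (d m n : ℕ) (H : ℕ) : ℕ :=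
  Nat.card {f : ℤ[X] // f.natDegree = d ∧ f ≠ 0 ∧ HeightLe f H ∧
    ∃ g h : ℤ[X], g.natDegree = m ∧ h.natDegree = n ∧ f = g.comp h}

lemma mahler_sub_ge (q : ℂ[X]) (n k : ℕ) (hq : (X * q).natDegree ≤ n) (b : ℂ) :
    ‖q.coeff k‖ ≤ 2 ^ n * (X * q - C b).mahlerMeasure ∧
    ‖b‖ ≤ 2 ^ n * (X * q - C b).mahlerMeasure := by
  have main : ∀ j, ‖(X * q - C b).coeff j‖ ≤ 2 ^ n * (X * q - C b).mahlerMeasure := by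
    intro j
    refine (norm_coeff_le_choose_mul_mahlerMeasure j _).trans ?_
    have h1 : (X * q - C b).natDegree ≤ n := by
      rw [natDegree_sub_C]; exact hq
    have h2 : ((X * q - C b).natDegree.choose j : ℝ) ≤ 2 ^ n := by
      have : (X * q - C b).natDegree.choose j ≤ 2 ^ n :=
        (Nat.choose_le_two_pow _ _).trans (Nat.pow_le_pow_right (by norm_num) h1)
      exact_mod_cast this
    exact mul_le_mul_of_nonneg_right h2 (mahlerMeasure_nonneg _)
  constructor
  · have := main (k + 1)
    simpa [coeff_C] using this
  · have := main 0
    simpa using this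

lemma key_multiset (q : ℂ[X]) (n k : ℕ) (hq : (X * q).natDegree ≤ n) (s : Multiset ℂ) :
    ∀ i, ‖((s.map (X - C ·)).prod).coeff i‖ * ‖q.coeff k‖ ^ i ≤
      (2 * 2 ^ n) ^ s.card * (((s.map (X - C ·)).prod).comp (X * q)).mahlerMeasure := by
  induction s using Multiset.induction_on with
  | empty =>
    intro i
    rcases i with _ | i
    · simp
    · simp [coeff_one]
  | cons b s ih =>
    intro i
    obtain ⟨h1, h2⟩ := mahler_sub_ge q n k hq b
    set Q := (s.map (X - C ·)).prod with hQ
    set T := ‖q.coeff k‖ with hT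
    set M := (X * q - C b).mahlerMeasure with hM
    set K := (2 * 2 ^ n : ℝ) ^ s.card * (Q.comp (X * q)).mahlerMeasure with hK
    have hT0 : 0 ≤ T := norm_nonneg _
    have hK0 : 0 ≤ K := mul_nonneg (by positivity) (mahlerMeasure_nonneg _)
    have e : (2 * 2 ^ n : ℝ) ^ (Multiset.card (b ::ₘ s)) *
        (((Multiset.map (X - C ·) (b ::ₘ s)).prod).comp (X * q)).mahlerMeasure
        = (2 * (2 ^ n * M)) * K := by
      rw [Multiset.map_cons, Multiset.prod_cons, mul_comp, mahlerMeasure_mul, Multiset.card_cons]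
      simp only [sub_comp, X_comp, C_comp, ← hM, ← hQ, hK]
      ring
    rw [e, Multiset.map_cons, Multiset.prod_cons, ← hQ, sub_mul, coeff_sub, coeff_C_mul]
    have hA : ‖(X * Q).coeff i‖ * T ^ i ≤ T * K := by
      rcases i with _ | i
      · simp; positivity
      · rw [coeff_X_mul, pow_succ]
        nlinarith [ih i]
    have hB : ‖b * Q.coeff i‖ * T ^ i ≤ ‖b‖ * K := by
      rw [norm_mul, mul_assoc]
      exact mul_le_mul_of_nonneg_left (ih i) (norm_nonneg _)
    calc ‖(X * Q).coeff i - b * Q.coeff i‖ * T ^ i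
        ≤ (‖(X * Q).coeff i‖ + ‖b * Q.coeff i‖) * T ^ i :=
          mul_le_mul_of_nonneg_right (norm_sub_le _ _) (by positivity)
      _ ≤ T * K + ‖b‖ * K := by rw [add_mul]; exact add_le_add hA hB
      _ ≤ (2 ^ n * M) * K + (2 ^ n * M) * K := by gcongr
      _ = _ := by ring

lemma key_complex (q G : ℂ[X]) (n k : ℕ) (hq : (X * q).natDegree ≤ n) (i : ℕ) :
    ‖G.coeff i‖ * ‖q.coeff k‖ ^ i ≤
      (2 * 2 ^ n) ^ G.natDegree * (G.comp (X * q)).mahlerMeasure := by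
  have hs := IsAlgClosed.splits G
  have e := hs.eq_prod_roots
  have hc : G.roots.card = G.natDegree := hs.natDegree_eq_card_roots.symm
  have h := key_multiset q n k hq G.roots i
  rw [hc] at h
  set P := (G.roots.map (X - C ·)).prod with hP
  have e1 : G.coeff i = G.leadingCoeff * P.coeff i := by
    conv_lhs => rw [e, coeff_C_mul]
  have e2 : (G.comp (X * q)).mahlerMeasure = ‖G.leadingCoeff‖ * (P.comp (X * q)).mahlerMeasure := by
    conv_lhs => rw [e, mul_comp, mahlerMeasure_mul, C_comp, mahlerMeasure_const]
  rw [e1, e2, norm_mul]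
  calc _ = ‖G.leadingCoeff‖ * (‖P.coeff i‖ * ‖q.coeff k‖ ^ i) := by ring
    _ ≤ ‖G.leadingCoeff‖ * _ := mul_le_mul_of_nonneg_left h (norm_nonneg _)
    _ = _ := by ring

lemma key_int (g q : ℤ[X]) (m n H k : ℕ) (hg : g.natDegree = m) (hq : (X * q).natDegree = n)
    (hH : HeightLe (g.comp (X * q)) H) (i : ℕ) :
    (g.coeff i).natAbs * (q.coeff k).natAbs ^ i ≤ (2 * 2 ^ n) ^ m * (m * n + 1) * H := by
  let v := Int.castRingHom ℂ
  have hv : Function.Injective v := Int.cast_injective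
  have h := key_complex (q.map v) (g.map v) n k (by
    have : (X * q.map v) = (X * q).map v := by simp
    rw [this, natDegree_map_eq_of_injective hv, hq]) i
  have e : (g.map v).comp (X * q.map v) = (g.comp (X * q)).map v := by
    rw [Polynomial.map_comp]; simp
  rw [natDegree_map_eq_of_injective hv, hg, e] at h
  have hM : ((g.comp (X * q)).map v).mahlerMeasure ≤ (m * n + 1) * H := by
    refine (mahlerMeasure_le_sum_norm_coeff _).trans ?_
    rw [sum_over_range _ (by simp), natDegree_map_eq_of_injective hv, natDegree_comp, hg, hq]
    refine (Finset.sum_le_card_nsmul _ _ (H : ℝ) ?_).trans ?_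
    · intro j _
      have := hH j
      rw [coeff_map]
      simp only [v, eq_intCast, Complex.norm_intCast]
      exact_mod_cast this
    · simp
  have h3 : ‖(g.map v).coeff i‖ * ‖(q.map v).coeff k‖ ^ i ≤
      (2 * 2 ^ n) ^ m * ((m * n + 1) * H) :=
    h.trans (mul_le_mul_of_nonneg_left hM (by positivity))
  rw [coeff_map, coeff_map] at h3
  simp only [v, eq_intCast, Complex.norm_intCast] at h3
  have : (((g.coeff i).natAbs * (q.coeff k).natAbs ^ i : ℕ) : ℝ) ≤
      (((2 * 2 ^ n) ^ m * (m * n + 1) * H : ℕ) : ℝ) := by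
    push_cast
    simp only [Nat.cast_natAbs, Int.cast_abs]
    linarith
  exact_mod_cast this

/-- The candidate polynomials whose inner polynomial has height exactly `T`, attained at `k`. -/
noncomputable def boxT (m n B T : ℕ) (k : Fin n) : Finset ((Fin (m + 1) → ℤ) × (Fin n → ℤ)) :=
  (Fintype.piFinset fun i : Fin (m + 1) =>
    Finset.Icc (-((B / T ^ (i : ℕ) : ℕ) : ℤ)) ((B / T ^ (i : ℕ) : ℕ) : ℤ)) ×ˢ
  (Fintype.piFinset fun j : Fin n =>
    if j = k then ({(T : ℤ), -(T : ℤ)} : Finset ℤ) else Finset.Icc (-(T : ℤ)) (T : ℤ))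

open Classical in
/-- All the candidates. -/
noncomputable def candT (m n B : ℕ) : Finset ℤ[X] :=
  ((Finset.Icc 1 B).filter fun T => T ^ m ≤ B).biUnion fun T =>
    (Finset.univ : Finset (Fin n)).biUnion fun k =>
      (boxT m n B T k).image fun p => (ofFn (m + 1) p.1).comp (X * ofFn n p.2)

lemma ofFn_coeff_self (p : ℤ[X]) (N : ℕ) (h : p.natDegree < N) :
    ofFn N (fun i : Fin N => p.coeff i) = p := by
  ext j
  by_cases hj : j < N
  · rw [ofFn_coeff_eq_val_of_lt _ hj]
  · rw [ofFn_coeff_eq_zero_of_ge _ (not_lt.mp hj), coeff_eq_zero_of_natDegree_lt (by omega)]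

lemma mem_cand (m n H : ℕ) (hm : 2 ≤ m) (hn : 2 ≤ n) (f : ℤ[X]) (hf : HeightLe f H)
    (hex : ∃ g h : ℤ[X], g.natDegree = m ∧ h.natDegree = n ∧ f = g.comp h) :
    f ∈ candT m n ((2 * 2 ^ n) ^ m * (m * n + 1) * H) := by
  obtain ⟨g, h, hg, hh, rfl⟩ := hex
  set B := (2 * 2 ^ n) ^ m * (m * n + 1) * H with hB
  set a := h.coeff 0 with ha
  set q := h.divX with hqdef
  set g₀ := g.comp (X + C a) with hg₀
  have hhq : X * q + C a = h := X_mul_divX_add h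
  have hcomp : g.comp h = g₀.comp (X * q) := by
    rw [hg₀, comp_assoc, ← hhq]; simp
  have hg₀d : g₀.natDegree = m := by
    rw [hg₀, natDegree_comp, natDegree_X_add_C, mul_one, hg]
  have hXq : (X * q).natDegree = n := by
    rw [← hh, ← hhq, natDegree_add_C]
  have hqd : q.natDegree < n := by
    rw [hqdef, natDegree_divX_eq_natDegree_tsub_one, hh]; omega
  have hq0 : q ≠ 0 := by
    intro h0; rw [h0] at hXq; simp at hXq; omega
  have : Nonempty (Fin n) := ⟨⟨0, by omega⟩⟩
  obtain ⟨k, hk⟩ := Finite.exists_max (fun j : Fin n => (q.coeff j).natAbs)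
  set T := (q.coeff k).natAbs with hT
  have hT1 : 1 ≤ T := by
    have := hk ⟨q.natDegree, hqd⟩
    have h2 : q.coeff q.natDegree ≠ 0 := by simpa using hq0
    have h3 := Int.natAbs_pos.mpr h2
    simp only at this
    omega
  have hkey : ∀ i, (g₀.coeff i).natAbs * T ^ i ≤ B := fun i =>
    key_int g₀ q m n H k hg₀d hXq (hcomp ▸ hf) i
  have hTm : T ^ m ≤ B := by
    have h1 := hkey m
    have h2 : g₀.coeff m ≠ 0 := by
      rw [← hg₀d]
      have : g₀ ≠ 0 := by
        intro h0; rw [h0] at hg₀d; simp at hg₀d; omega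
      simpa using this
    have h3 := Int.natAbs_pos.mpr h2
    nlinarith [Nat.zero_le (T ^ m)]
  have hTB : T ≤ B := (Nat.le_self_pow (by omega) T).trans hTm
  unfold candT
  simp only [Finset.mem_biUnion, Finset.mem_filter, Finset.mem_Icc, Finset.mem_univ, true_and,
    Finset.mem_image]
  refine ⟨T, ⟨⟨hT1, hTB⟩, hTm⟩, k, (fun i => g₀.coeff i, fun j => q.coeff j), ?_, ?_⟩
  · simp only [boxT, Finset.mem_product, Fintype.mem_piFinset]
    constructor
    · intro i
      have : (g₀.coeff i).natAbs ≤ B / T ^ (i : ℕ) :=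
        (Nat.le_div_iff_mul_le (by positivity)).mpr (hkey i)
      rw [Finset.mem_Icc]
      omega
    · intro j
      have h1 := hk j
      split_ifs with hjk
      · subst hjk
        simp only [Finset.mem_insert, Finset.mem_singleton]
        omega
      · rw [Finset.mem_Icc]
        omega
  · simp only
    rw [hcomp, ofFn_coeff_self _ _ (by omega), ofFn_coeff_self _ _ hqd]

lemma card_box (m n B T : ℕ) (k : Fin n) (hT : 1 ≤ T) (hTB : T ^ m ≤ B)
    (hcond : 2 * (n + 1) ≤ m * (m + 1)) :
    ((boxT m n B T k).card : ℝ) ≤ 3 ^ (m + 1) * 3 ^ n * (B : ℝ) ^ (m + 1) * ((T : ℝ) ^ 2)⁻¹ := by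
  have hT0 : (1 : ℝ) ≤ T := by exact_mod_cast hT
  have hTpos : (0 : ℝ) < T := by linarith
  rw [boxT, Finset.card_product, Fintype.card_piFinset, Fintype.card_piFinset]
  push_cast
  have h1 : (∏ i : Fin (m + 1), ((Finset.Icc (-((B / T ^ (i : ℕ) : ℕ) : ℤ))
      ((B / T ^ (i : ℕ) : ℕ) : ℤ)).card : ℝ)) ≤
      3 ^ (m + 1) * (B : ℝ) ^ (m + 1) * ((T : ℝ) ^ (n + 1))⁻¹ := by
    calc _ ≤ ∏ i : Fin (m + 1), (3 * (B : ℝ) * ((T : ℝ) ^ (i : ℕ))⁻¹) := by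
          refine Finset.prod_le_prod (fun _ _ => by positivity) ?_
          intro i _
          have hi : T ^ (i : ℕ) ≤ B :=
            (Nat.pow_le_pow_right hT (by omega)).trans hTB
          have hL : 1 ≤ B / T ^ (i : ℕ) := (Nat.one_le_div_iff (by positivity)).mpr hi
          have hcard : (Finset.Icc (-((B / T ^ (i : ℕ) : ℕ) : ℤ))
              ((B / T ^ (i : ℕ) : ℕ) : ℤ)).card ≤ 3 * (B / T ^ (i : ℕ)) := by
            rw [Int.card_Icc]; omega
          have h3 : ((B / T ^ (i : ℕ) : ℕ) : ℝ) ≤ (B : ℝ) / (T : ℝ) ^ (i : ℕ) := by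
            have := @Nat.cast_div_le ℝ _ _ _ B (T ^ (i : ℕ))
            simpa using this
          have h4 : ((Finset.Icc (-((B / T ^ (i : ℕ) : ℕ) : ℤ))
              ((B / T ^ (i : ℕ) : ℕ) : ℤ)).card : ℝ) ≤ 3 * ((B / T ^ (i : ℕ) : ℕ) : ℝ) := by
            exact_mod_cast hcard
          rw [div_eq_mul_inv] at h3
          linarith
      _ = 3 ^ (m + 1) * (B : ℝ) ^ (m + 1) * ((T : ℝ) ^ (∑ i ∈ Finset.range (m + 1), i))⁻¹ := by
          rw [Finset.prod_mul_distrib, Finset.prod_const, Finset.prod_inv_distrib,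
            Fin.prod_univ_eq_prod_range (fun i => (T : ℝ) ^ i) (m + 1), Finset.prod_pow_eq_pow_sum]
          simp [mul_pow]
      _ ≤ _ := by
          have : n + 1 ≤ ∑ i ∈ Finset.range (m + 1), i := by
            have h := Finset.sum_range_id_mul_two (m + 1)
            simp only [Nat.add_sub_cancel] at h
            nlinarith
          gcongr
  have h2 : (∏ j : Fin n, ((if j = k then ({(T : ℤ), -(T : ℤ)} : Finset ℤ) else
      Finset.Icc (-(T : ℤ)) (T : ℤ)).card : ℝ)) ≤ 3 ^ n * (T : ℝ) ^ (n - 1) := by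
    calc _ ≤ ∏ j : Fin n, (3 * (if j = k then 1 else (T : ℝ))) := by
          refine Finset.prod_le_prod (fun _ _ => by positivity) ?_
          intro j _
          split_ifs
          · have : ({(T : ℤ), -(T : ℤ)} : Finset ℤ).card ≤ 3 := Finset.card_le_two.trans (by norm_num)
            rw [mul_one]
            exact_mod_cast this
          · have : (Finset.Icc (-(T : ℤ)) (T : ℤ)).card ≤ 3 * T := by
              rw [Int.card_Icc]; omega
            exact_mod_cast this
      _ = _ := by
          rw [Finset.prod_mul_distrib, Finset.prod_const, Finset.prod_ite]
          simp [Finset.filter_ne', Finset.card_erase_of_mem]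
  have hn : 1 ≤ n := by have := k.2; omega
  calc _ ≤ (3 ^ (m + 1) * (B : ℝ) ^ (m + 1) * ((T : ℝ) ^ (n + 1))⁻¹) *
        (3 ^ n * (T : ℝ) ^ (n - 1)) :=
        mul_le_mul h1 h2 (by positivity) (by positivity)
    _ = _ := by
        obtain ⟨r, rfl⟩ : ∃ r, n = r + 1 := ⟨n - 1, by omega⟩
        simp only [Nat.add_sub_cancel]
        field_simp
        ring

lemma card_cand (m n B : ℕ) (hcond : 2 * (n + 1) ≤ m * (m + 1)) :
    ((candT m n B).card : ℝ) ≤ 2 * (n * (3 ^ (m + 1) * 3 ^ n)) * (B : ℝ) ^ (m + 1) := by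
  classical
  have h1 : ((candT m n B).card : ℝ) ≤ ∑ T ∈ (Finset.Icc 1 B).filter (fun T => T ^ m ≤ B),
      ∑ k : Fin n, ((boxT m n B T k).card : ℝ) := by
    have : (candT m n B).card ≤ ∑ T ∈ (Finset.Icc 1 B).filter (fun T => T ^ m ≤ B),
      ∑ k : Fin n, (boxT m n B T k).card := by
      unfold candT
      refine Finset.card_biUnion_le.trans (Finset.sum_le_sum fun T _ => ?_)
      refine Finset.card_biUnion_le.trans (Finset.sum_le_sum fun k _ => ?_)
      exact Finset.card_image_le
    exact_mod_cast this
  refine h1.trans ?_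
  calc _ ≤ ∑ T ∈ (Finset.Icc 1 B).filter (fun T => T ^ m ≤ B),
      (n * (3 ^ (m + 1) * 3 ^ n)) * (B : ℝ) ^ (m + 1) * ((T : ℝ) ^ 2)⁻¹ := by
        refine Finset.sum_le_sum fun T hT => ?_
        rw [Finset.mem_filter, Finset.mem_Icc] at hT
        refine (Finset.sum_le_card_nsmul _ _ _ fun k _ =>
          card_box m n B T k hT.1.1 hT.2 hcond).trans (le_of_eq ?_)
        simp
        ring
    _ = (n * (3 ^ (m + 1) * 3 ^ n)) * (B : ℝ) ^ (m + 1) *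
        ∑ T ∈ (Finset.Icc 1 B).filter (fun T => T ^ m ≤ B), ((T : ℝ) ^ 2)⁻¹ := by
        rw [Finset.mul_sum]
    _ ≤ (n * (3 ^ (m + 1) * 3 ^ n)) * (B : ℝ) ^ (m + 1) * 2 := by
        refine mul_le_mul_of_nonneg_left ?_ (by positivity)
        have h := sum_Ioo_inv_sq_le (α := ℝ) 0 (B + 1)
        refine le_trans (Finset.sum_le_sum_of_subset_of_nonneg ?_ fun _ _ _ => by positivity)
          (h.trans (by norm_num))
        intro T hT
        rw [Finset.mem_filter, Finset.mem_Icc] at hT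
        rw [Finset.mem_Ioo]
        omega
    _ = _ := by ring

lemma lower_mem (m n H : ℕ) (hm : 2 ≤ m) (hn : 2 ≤ n) (v : Fin (m + 1) → ℤ)
    (hv : ∀ i, v i ∈ Finset.Icc (1 : ℤ) H) :
    (expand ℤ n (ofFn (m + 1) v)).natDegree = m * n ∧ expand ℤ n (ofFn (m + 1) v) ≠ 0 ∧
    HeightLe (expand ℤ n (ofFn (m + 1) v)) H ∧
    ∃ g h : ℤ[X], g.natDegree = m ∧ h.natDegree = n ∧
      expand ℤ n (ofFn (m + 1) v) = g.comp h := by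
  have hc : (ofFn (m + 1) v).coeff m ≠ 0 := by
    rw [ofFn_coeff_eq_val_of_lt _ (Nat.lt_succ_self m)]
    have := hv ⟨m, Nat.lt_succ_self m⟩
    rw [Finset.mem_Icc] at this
    omega
  have hd : (ofFn (m + 1) v).natDegree = m := by
    have h1 := ofFn_natDegree_lt (R := ℤ) (n := m + 1) (by omega) v
    have h2 := le_natDegree_of_ne_zero hc
    omega
  refine ⟨by rw [natDegree_expand, hd], ?_, ?_, ofFn (m + 1) v, X ^ n, hd, natDegree_X_pow n,
    expand_eq_comp_X_pow n⟩
  · rw [expand_ne_zero (by omega)]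
    intro h0; rw [h0] at hc; simp at hc
  · intro i
    rw [coeff_expand (by omega)]
    split_ifs
    · by_cases hj : i / n < m + 1
      · rw [ofFn_coeff_eq_val_of_lt _ hj]
        have := hv ⟨i / n, hj⟩
        rw [Finset.mem_Icc] at this
        rw [abs_le]; omega
      · rw [ofFn_coeff_eq_zero_of_ge _ (not_lt.mp hj)]; simp
    · simp

theorem stmt_8 (d m n : ℕ) (hd : 4 ≤ d) (hm : 2 ≤ m) (hn : 2 ≤ n) (hmn : d = m * n)
    (hcond : 2 * (n + 1) ≤ m * (m + 1)) :
    ∃ c₁ c₂ : ℝ, 0 < c₁ ∧ 0 < c₂ ∧ ∀ H : ℕ, 2 ≤ H →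
      c₁ * (H : ℝ) ^ (m + 1) ≤ (DStar d m n H : ℝ) ∧
      (DStar d m n H : ℝ) ≤ c₂ * (H : ℝ) ^ (m + 1) := by
  classical
  subst hmn
  refine ⟨1, 2 * (n * (3 ^ (m + 1) * 3 ^ n)) * ((2 * 2 ^ n) ^ m * (m * n + 1)) ^ (m + 1),
    one_pos, by positivity, fun H hH => ?_⟩
  set S : Set ℤ[X] := {f : ℤ[X] | f.natDegree = m * n ∧ f ≠ 0 ∧ HeightLe f H ∧
    ∃ g h : ℤ[X], g.natDegree = m ∧ h.natDegree = n ∧ f = g.comp h} with hS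
  have hD : DStar (m * n) m n H = S.ncard := rfl
  set B := (2 * 2 ^ n) ^ m * (m * n + 1) * H with hB
  have hsub : S ⊆ (candT m n B : Set ℤ[X]) := fun f hf =>
    mem_cand m n H hm hn f hf.2.2.1 hf.2.2.2
  have hfin : S.Finite := (candT m n B).finite_toSet.subset hsub
  rw [hD]
  constructor
  · let V := Fintype.piFinset fun _ : Fin (m + 1) => Finset.Icc (1 : ℤ) H
    let I := V.image fun v => expand ℤ n (ofFn (m + 1) v)
    have hI : (I : Set ℤ[X]) ⊆ S := by
      intro f hf
      rw [Finset.mem_coe, Finset.mem_image] at hf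
      obtain ⟨v, hv, rfl⟩ := hf
      exact lower_mem m n H hm hn v (Fintype.mem_piFinset.mp hv)
    have hIc : I.card = H ^ (m + 1) := by
      rw [Finset.card_image_of_injective]
      · simp [V]
      · exact (expand_injective (by omega)).comp (injective_ofFn (m + 1))
    have h1 := Set.ncard_le_ncard hI hfin
    rw [Set.ncard_coe_finset, hIc] at h1
    rw [one_mul]
    exact_mod_cast h1
  · have h1 := Set.ncard_le_ncard hsub (candT m n B).finite_toSet
    rw [Set.ncard_coe_finset] at h1
    have h2 : (S.ncard : ℝ) ≤ (candT m n B).card := by exact_mod_cast h1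
    refine h2.trans ((card_cand m n B hcond).trans (le_of_eq ?_))
    rw [hB]
    push_cast
    rw [mul_pow _ (H : ℝ) (m + 1), ← mul_assoc]
end

section
/- Let d ≥ 4 be an integer and let m, n be integers with m ≥ 2, n ≥ 2 and d = mn. If m(m+1) = 2n, then there exists a constant c > 0 (depending only on d) such that for all integers H ≥ 2, D*_d(m,n;H) ≤ c·H^{m+1}·log H, where log denotes the natural logarithm. -/
open Polynomial

/-- polynomial with coefficient vector `u`. -/
noncomputable def polyU {R : Type} [CommRing R] (m : ℕ) (u : Fin (m + 1) → R) : R[X] :=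
  ∑ k : Fin (m + 1), C (u k) * X ^ (k : ℕ)

/-- polynomial without constant term with coefficient vector `v`. -/
noncomputable def polyV {R : Type} [CommRing R] (n : ℕ) (v : Fin n → R) : R[X] :=
  ∑ i : Fin n, C (v i) * X ^ ((i : ℕ) + 1)

lemma coeff_polyU {R : Type} [CommRing R] (m : ℕ) (u : Fin (m + 1) → R) (k : Fin (m + 1)) :
    (polyU m u).coeff k = u k := by
  simp [polyU, Polynomial.finsetSum_coeff, coeff_C_mul, coeff_X_pow, Fin.val_inj]

lemma coeff_polyV {R : Type} [CommRing R] (n : ℕ) (v : Fin n → R) (k : Fin n) :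
    (polyV n v).coeff (k + 1) = v k := by
  simp [polyV, Polynomial.finsetSum_coeff, coeff_C_mul, coeff_X_pow, Fin.val_inj]

lemma natDegree_polyU {R : Type} [CommRing R] (m : ℕ) (u : Fin (m + 1) → R) :
    (polyU m u).natDegree ≤ m := by
  refine natDegree_sum_le_of_forall_le _ _ fun k _ => ?_
  exact (natDegree_C_mul_X_pow_le _ _).trans (by omega)

lemma natDegree_polyV {R : Type} [CommRing R] (n : ℕ) (v : Fin n → R) :
    (polyV n v).natDegree ≤ n := by
  refine natDegree_sum_le_of_forall_le _ _ fun k _ => ?_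
  exact (natDegree_C_mul_X_pow_le _ _).trans (by omega)

lemma eval_comp_polyUV {R : Type} [CommRing R] (m n : ℕ) (u : Fin (m + 1) → R) (v : Fin n → R)
    (x : R) : ((polyU m u).comp (polyV n v)).eval x =
      ∑ k : Fin (m + 1), u k * (∑ i : Fin n, v i * x ^ ((i : ℕ) + 1)) ^ (k : ℕ) := by
  simp [polyU, polyV, eval_finsetSum]

lemma comp_ne_zero' (m n : ℕ) (u : Fin (m + 1) → ℝ) (v : Fin n → ℝ) (hu : u ≠ 0) (hv : v ≠ 0) :
    (polyU m u).comp (polyV n v) ≠ 0 := by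
  intro h
  rcases comp_eq_zero_iff.1 h with h | ⟨_, h⟩
  · apply hu
    ext k
    rw [← coeff_polyU m u k, h]; simp
  · apply hv
    ext k
    rw [← coeff_polyV n v k, h]; simp [coeff_C]

lemma exists_lower (m n : ℕ) (hn : 1 ≤ n) : ∃ c : ℝ, 0 < c ∧ ∀ (u : Fin (m + 1) → ℝ) (v : Fin n → ℝ),
    ‖u‖ = 1 → ‖v‖ = 1 → c ≤ ∑ j ∈ Finset.range (m * n + 1),
      |∑ k : Fin (m + 1), u k * (∑ i : Fin n, v i * (j : ℝ) ^ ((i : ℕ) + 1)) ^ (k : ℕ)| := by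
  haveI : Nonempty (Fin n) := ⟨⟨0, hn⟩⟩
  have hcomp : IsCompact ((Metric.sphere (0 : Fin (m + 1) → ℝ) 1) ×ˢ
      (Metric.sphere (0 : Fin n → ℝ) 1)) := (isCompact_sphere _ _).prod (isCompact_sphere _ _)
  have hne : ((Metric.sphere (0 : Fin (m + 1) → ℝ) 1) ×ˢ
      (Metric.sphere (0 : Fin n → ℝ) 1)).Nonempty :=
    Set.Nonempty.prod (NormedSpace.sphere_nonempty.2 zero_le_one)
      (NormedSpace.sphere_nonempty.2 zero_le_one)
  obtain ⟨p, hp, hmin⟩ := hcomp.exists_isMinOn hne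
    (f := fun p : (Fin (m + 1) → ℝ) × (Fin n → ℝ) => ∑ j ∈ Finset.range (m * n + 1),
      |∑ k : Fin (m + 1), p.1 k * (∑ i : Fin n, p.2 i * (j : ℝ) ^ ((i : ℕ) + 1)) ^ (k : ℕ)|)
    (by fun_prop)
  refine ⟨_, ?_, fun u v hu hv => hmin (a := (u, v)) (by simp [hu, hv])⟩
  have hp1 : ‖p.1‖ = 1 := by simpa using hp.1
  have hp2 : ‖p.2‖ = 1 := by simpa using hp.2
  have hnz := comp_ne_zero' m n p.1 p.2 (by intro h; simp [h] at hp1) (by intro h; simp [h] at hp2)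
  refine lt_of_le_of_ne (Finset.sum_nonneg fun _ _ => abs_nonneg _) fun h0 => hnz ?_
  have h0 := (Finset.sum_eq_zero_iff_of_nonneg (fun _ _ => abs_nonneg _)).1 h0.symm
  refine Polynomial.eq_zero_of_natDegree_lt_card_of_eval_eq_zero' _
    ((Finset.range (m * n + 1)).map ⟨fun j : ℕ => (j : ℝ), Nat.cast_injective⟩) ?_ ?_
  · intro x hx
    obtain ⟨j, hj, rfl⟩ := Finset.mem_map.1 hx
    rw [eval_comp_polyUV]
    exact abs_eq_zero.1 (h0 j hj)
  · rw [Finset.card_map, Finset.card_range]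
    have := natDegree_comp_le (p := polyU m p.1) (q := polyV n p.2)
    have := Nat.mul_le_mul (natDegree_polyU m p.1) (natDegree_polyV n p.2)
    omega

lemma eval_bound (D : ℕ) (f : ℤ[X]) (hf : f.natDegree ≤ D) (H : ℕ) (hH : HeightLe f H) (j : ℕ)
    (hj : j ≤ D) : |((f.eval (j : ℤ) : ℤ) : ℝ)| ≤ (D + 1) * (D + 1 : ℝ) ^ D * H := by
  have h1 : |f.eval (j : ℤ)| ≤ ∑ i ∈ Finset.range (D + 1), (H : ℤ) * (D + 1) ^ D := by
    rw [eval_eq_sum_range' (Nat.lt_succ_of_le hf)]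
    refine (Finset.abs_sum_le_sum_abs _ _).trans (Finset.sum_le_sum fun i hi => ?_)
    rw [abs_mul]
    refine mul_le_mul (hH i) ?_ (abs_nonneg _) (by positivity)
    rw [abs_of_nonneg (by positivity)]
    calc (j : ℤ) ^ i ≤ ((D : ℤ) + 1) ^ i := by gcongr; omega
      _ ≤ ((D : ℤ) + 1) ^ D := by
        apply pow_le_pow_right₀ (by omega)
        have := Finset.mem_range.1 hi; omega
  have h2 : |((f.eval (j : ℤ) : ℤ) : ℝ)| ≤ ∑ i ∈ Finset.range (D + 1), (H : ℝ) * (D + 1) ^ D := by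
    exact_mod_cast h1
  refine h2.trans (le_of_eq ?_)
  simp; ring

/-- Key bound on the coefficients. -/
lemma key_bound_s9 (m n : ℕ) (hn : 1 ≤ n) : ∃ K : ℕ, 1 ≤ K ∧ ∀ (H : ℕ) (u : Fin (m + 1) → ℤ)
    (v : Fin n → ℤ) (A : ℕ), 1 ≤ A → (∀ i, |v i| ≤ A) → (∃ i, |v i| = A) →
    HeightLe ((polyU m u).comp (polyV n v)) H → ∀ k, (u k).natAbs * A ^ (k : ℕ) ≤ K * H := by
  obtain ⟨c, hc, hlow⟩ := exists_lower m n hn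
  set E : ℝ := (((m * n : ℕ) : ℝ) + 1) * ((((m * n : ℕ) : ℝ) + 1) * (((m * n : ℕ) : ℝ) + 1) ^ (m * n))
    with hE
  obtain ⟨K, hK⟩ := exists_nat_ge (E / c)
  refine ⟨K + 1, by omega, fun H u v A hA hv hv' hH k => ?_⟩
  have hA0 : (0 : ℝ) < A := by exact_mod_cast hA
  set U : Fin (m + 1) → ℝ := fun k => (u k : ℝ) * (A : ℝ) ^ (k : ℕ) with hU
  set V : Fin n → ℝ := fun i => (v i : ℝ) / A with hV
  have hVn : ‖V‖ = 1 := by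
    apply le_antisymm
    · refine (pi_norm_le_iff_of_nonneg zero_le_one).2 fun i => ?_
      rw [hV, Real.norm_eq_abs, abs_div, abs_of_pos hA0, div_le_one hA0]
      exact_mod_cast hv i
    · obtain ⟨i, hi⟩ := hv'
      refine le_trans (le_of_eq ?_) (norm_le_pi_norm V i)
      rw [hV, Real.norm_eq_abs, abs_div, abs_of_pos hA0, eq_div_iff hA0.ne', one_mul]
      exact_mod_cast hi.symm
  have hmain : c * ‖U‖ ≤ E * H := by
    rcases eq_or_ne U 0 with h0 | h0
    · rw [h0, norm_zero, mul_zero]; positivity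
    have hpos : 0 < ‖U‖ := norm_pos_iff.2 h0
    have h1 := hlow (fun k => ‖U‖⁻¹ * U k) V (by
      have : (fun k => ‖U‖⁻¹ * U k) = ‖U‖⁻¹ • U := by ext; simp
      rw [this, norm_smul, norm_inv, norm_norm, inv_mul_cancel₀ hpos.ne']) hVn
    have h2 : ∀ j : ℕ, ∑ k : Fin (m + 1), ‖U‖⁻¹ * U k *
        (∑ i : Fin n, V i * (j : ℝ) ^ ((i : ℕ) + 1)) ^ (k : ℕ) =
        ‖U‖⁻¹ * ((((polyU m u).comp (polyV n v)).eval (j : ℤ) : ℤ) : ℝ) := by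
      intro j
      rw [eval_comp_polyUV]
      push_cast
      rw [Finset.mul_sum]
      refine Finset.sum_congr rfl fun k _ => ?_
      have : ∑ i : Fin n, V i * (j : ℝ) ^ ((i : ℕ) + 1) =
          (∑ i : Fin n, (v i : ℝ) * (j : ℝ) ^ ((i : ℕ) + 1)) / A := by
        rw [Finset.sum_div]
        exact Finset.sum_congr rfl fun i _ => by rw [hV]; ring
      rw [this, hU, div_pow]
      field_simp
    have h3 : ∑ j ∈ Finset.range (m * n + 1), |∑ k : Fin (m + 1), ‖U‖⁻¹ * U k *
        (∑ i : Fin n, V i * (j : ℝ) ^ ((i : ℕ) + 1)) ^ (k : ℕ)| ≤ ‖U‖⁻¹ * (E * H) := by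
      calc _ ≤ ∑ j ∈ Finset.range (m * n + 1), ‖U‖⁻¹ *
            ((((m * n : ℕ) : ℝ) + 1) * (((m * n : ℕ) : ℝ) + 1) ^ (m * n) * H) := by
            refine Finset.sum_le_sum fun j hj => ?_
            rw [h2, abs_mul, abs_of_pos (inv_pos.2 hpos)]
            refine mul_le_mul_of_nonneg_left ?_ (inv_pos.2 hpos).le
            refine eval_bound (m * n) _ ?_ H hH j (by have := Finset.mem_range.1 hj; omega)
            exact natDegree_comp_le.trans
              (Nat.mul_le_mul (natDegree_polyU m u) (natDegree_polyV n v))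
        _ = _ := by
          rw [Finset.sum_const, Finset.card_range, nsmul_eq_mul, hE]; push_cast; ring
    have h4 := h1.trans h3
    rw [inv_mul_eq_div, le_div_iff₀ hpos] at h4
    exact h4
  have h5 : |(u k : ℝ)| * (A : ℝ) ^ (k : ℕ) ≤ ‖U‖ := by
    have := norm_le_pi_norm U k
    rwa [hU, Real.norm_eq_abs, abs_mul, abs_of_pos (by positivity : (0 : ℝ) < (A : ℝ) ^ (k : ℕ))]
      at this
  have h6 : ‖U‖ ≤ (K + 1 : ℝ) * H := by
    have : ‖U‖ ≤ E / c * H := by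
      rw [div_mul_eq_mul_div, le_div_iff₀ hc, mul_comm]; exact hmain
    refine this.trans (mul_le_mul_of_nonneg_right (by linarith) (by positivity))
  have h7 := h5.trans h6
  zify
  exact_mod_cast h7

lemma decomp (m n : ℕ) (hn : 1 ≤ n) (g h : ℤ[X]) (hg : g.natDegree = m) (hh : h.natDegree = n)
    (hm : 1 ≤ m) :
    ∃ (u : Fin (m + 1) → ℤ) (v : Fin n → ℤ), u (Fin.last m) ≠ 0 ∧ v ≠ 0 ∧
      g.comp h = (polyU m u).comp (polyV n v) := by
  set g' := g.comp (X + C (h.coeff 0)) with hg'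
  set h' := h - C (h.coeff 0) with hh'
  have hgd : g'.natDegree = m := by rw [hg', natDegree_comp, natDegree_X_add_C, hg, mul_one]
  have hhd : h'.natDegree = n := by rw [hh', natDegree_sub_C, hh]
  refine ⟨fun k => g'.coeff k, fun i => h'.coeff (i + 1), ?_, ?_, ?_⟩
  · simp only [Fin.val_last]
    rw [← hgd]
    simp only [coeff_natDegree]
    exact leadingCoeff_ne_zero.2 (by rintro h; simp [h] at hgd; omega)
  · intro h0
    have := congrFun h0 ⟨n - 1, by omega⟩
    simp only [Pi.zero_apply, Nat.sub_add_cancel hn] at this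
    rw [← hhd, coeff_natDegree, leadingCoeff_eq_zero] at this
    simp [this] at hhd; omega
  · have e1 : polyU m (fun k => g'.coeff k) = g' := by
      rw [polyU, Fin.sum_univ_eq_sum_range (fun k => C (g'.coeff k) * X ^ k)]
      exact (as_sum_range_C_mul_X_pow' (n := m + 1) g' (by omega)).symm
    have e2 : polyV n (fun i => h'.coeff (i + 1)) = h' := by
      rw [polyV, Fin.sum_univ_eq_sum_range (fun k => C (h'.coeff (k + 1)) * X ^ (k + 1))]
      conv_rhs => rw [as_sum_range_C_mul_X_pow' (n := n + 1) h' (by omega), Finset.sum_range_succ']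
      simp [hh']
    rw [e1, e2, hg', hh', comp_assoc]
    simp

/-- box of integer vectors. -/
noncomputable def boxV (n A : ℕ) : Finset (Fin n → ℤ) :=
  Fintype.piFinset fun _ => Finset.Icc (-(A : ℤ)) A

/-- box of integer vectors for `u`. -/
noncomputable def boxU (m A B : ℕ) : Finset (Fin (m + 1) → ℤ) :=
  Fintype.piFinset fun k => Finset.Icc (-((B / A ^ (k : ℕ) : ℕ) : ℤ)) (B / A ^ (k : ℕ) : ℕ)

lemma card_boxV (n A : ℕ) : (boxV n A).card = (2 * A + 1) ^ n := by
  simp only [boxV, Fintype.card_piFinset, Int.card_Icc, Finset.prod_const, Finset.card_univ,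
    Fintype.card_fin]
  congr 1; omega

lemma card_shell (n A : ℕ) (hA : 1 ≤ A) :
    ((boxV n A \ boxV n (A - 1)).card : ℝ) * A ≤ 2 * n * 3 ^ n * (A : ℝ) ^ n := by
  have hsub : boxV n (A - 1) ⊆ boxV n A := by
    intro v hv
    simp only [boxV, Fintype.mem_piFinset, Finset.mem_Icc] at hv ⊢
    intro i; have := hv i; omega
  rw [Finset.cast_card_sdiff hsub, card_boxV, card_boxV]
  obtain ⟨a, rfl⟩ : ∃ a, A = a + 1 := ⟨A - 1, by omega⟩
  rw [Nat.add_sub_cancel]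
  push_cast
  set x : ℝ := 2 * ((a : ℝ) + 1) + 1 with hx
  have hx3 : 3 ≤ x := by have : (0 : ℝ) ≤ a := by positivity
                         linarith
  have hxp : 0 < x := by linarith
  have hb := one_add_mul_le_pow (a := -2 / x) (by rw [le_div_iff₀ hxp]; linarith) n
  have h1 : (2 * (a : ℝ) + 1) ^ n = x ^ n * (1 + -2 / x) ^ n := by
    rw [← mul_pow]; congr 1; field_simp; rw [hx]; ring
  have h2 : x ^ n - (2 * (a : ℝ) + 1) ^ n ≤ 2 * n * x ^ n / x := by
    have := mul_le_mul_of_nonneg_left hb (pow_pos hxp n).le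
    rw [h1]
    have e : x ^ n * (1 + n * (-2 / x)) = x ^ n - 2 * n * x ^ n / x := by ring
    linarith
  have h3 : x ^ n ≤ 3 ^ n * ((a : ℝ) + 1) ^ n := by
    rw [← mul_pow]
    apply pow_le_pow_left₀ hxp.le
    have : (0 : ℝ) ≤ a := by positivity
    linarith
  have h4 : ((a : ℝ) + 1) ≤ x := by have : (0 : ℝ) ≤ a := by positivity
                                    linarith
  calc _ ≤ 2 * n * x ^ n / x * ((a : ℝ) + 1) := mul_le_mul_of_nonneg_right h2 (by positivity)
    _ ≤ 2 * n * x ^ n / x * x := mul_le_mul_of_nonneg_left h4 (by positivity)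
    _ = 2 * n * x ^ n := by field_simp
    _ ≤ 2 * n * (3 ^ n * ((a : ℝ) + 1) ^ n) := mul_le_mul_of_nonneg_left h3 (by positivity)
    _ = _ := by ring

lemma card_boxU (m n A B : ℕ) (hA : 1 ≤ A) (hAB : A ^ m ≤ B) (hc : m * (m + 1) = 2 * n) :
    ((boxU m A B).card : ℝ) * (A : ℝ) ^ n ≤ 3 ^ (m + 1) * (B : ℝ) ^ (m + 1) := by
  have hA0 : (0 : ℝ) < A := by exact_mod_cast hA
  have hprod : (A : ℝ) ^ n = ∏ k : Fin (m + 1), (A : ℝ) ^ (k : ℕ) := by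
    rw [Fin.prod_univ_eq_prod_range (fun k => (A : ℝ) ^ k), Finset.prod_pow_eq_pow_sum]
    congr 1
    have := Finset.sum_range_id_mul_two (m + 1)
    simp only [Nat.add_sub_cancel] at this
    linarith
  rw [boxU, Fintype.card_piFinset, hprod]
  push_cast
  rw [← Finset.prod_mul_distrib, ← mul_pow]
  calc _ ≤ ∏ k : Fin (m + 1), (3 * (B : ℝ)) := by
        refine Finset.prod_le_prod (fun _ _ => by positivity) fun k _ => ?_
        have hk : A ^ (k : ℕ) ≤ B := (Nat.pow_le_pow_right hA (by omega)).trans hAB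
        have h1 : 1 ≤ B / A ^ (k : ℕ) := (Nat.one_le_div_iff (by positivity)).2 hk
        have h2 := Nat.div_mul_le_self B (A ^ (k : ℕ))
        rw [Int.card_Icc]
        have h3 : ((((B / A ^ (k : ℕ) : ℕ) : ℤ) + 1 - -((B / A ^ (k : ℕ) : ℕ) : ℤ)).toNat)
          ≤ 3 * (B / A ^ (k : ℕ)) := by
          generalize B / A ^ (k : ℕ) = q at *
          omega
        have h4 := (Nat.mul_le_mul_right (A ^ (k : ℕ)) h3).trans
          (by rw [mul_assoc]; exact Nat.mul_le_mul_left 3 h2 :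
            3 * (B / A ^ (k : ℕ)) * A ^ (k : ℕ) ≤ 3 * B)
        exact_mod_cast h4
    _ = _ := by simp

theorem stmt_9 (d m n : ℕ) (hd : 4 ≤ d) (hm : 2 ≤ m) (hn : 2 ≤ n) (hmn : d = m * n)
    (hcond : m * (m + 1) = 2 * n) :
    ∃ c : ℝ, 0 < c ∧ ∀ H : ℕ, 2 ≤ H →
      (DStar d m n H : ℝ) ≤ c * (H : ℝ) ^ (m + 1) * Real.log H := by
  classical
  obtain ⟨K, hK, hkey⟩ := key_bound_s9 m n (by omega)
  set M : ℝ := 2 * n * 3 ^ n * (3 ^ (m + 1) * (K : ℝ) ^ (m + 1)) with hM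
  have hlog2 : 0 < Real.log 2 := Real.log_pos (by norm_num)
  have hlogK : 0 ≤ Real.log K := Real.log_nonneg (by exact_mod_cast hK)
  have hMpos : 0 < M := by positivity
  refine ⟨M * ((1 + Real.log K) / Real.log 2 + 1), by positivity, fun H hH => ?_⟩
  set S : Finset ℤ[X] := ((Finset.Icc 1 (K * H)).filter (fun A => A ^ m ≤ K * H)).biUnion fun A =>
    (boxU m A (K * H) ×ˢ (boxV n A \ boxV n (A - 1))).image
      fun p => (polyU m p.1).comp (polyV n p.2) with hS
  have hsub : {f : ℤ[X] | f.natDegree = d ∧ f ≠ 0 ∧ HeightLe f H ∧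
      ∃ g h : ℤ[X], g.natDegree = m ∧ h.natDegree = n ∧ f = g.comp h} ⊆ (S : Set ℤ[X]) := by
    rintro f ⟨-, -, hfH, g, h, hg, hh, hf⟩
    obtain ⟨u, v, hu, hv, huv⟩ := decomp m n (by omega) g h hg hh (by omega)
    rw [huv] at hf
    subst hf
    obtain ⟨i, -, hi⟩ := Finset.exists_max_image Finset.univ (fun i => (v i).natAbs)
      ⟨⟨0, by omega⟩, Finset.mem_univ _⟩
    have hA : 1 ≤ (v i).natAbs := by
      by_contra hcon
      apply hv
      ext j
      have := hi j (Finset.mem_univ _)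
      simp only [Pi.zero_apply]
      omega
    generalize hAdef : (v i).natAbs = A at *
    have hb := hkey H u v A hA (fun j => by have := hi j (Finset.mem_univ _); rw [Int.abs_eq_natAbs]; omega)
      ⟨i, by rw [Int.abs_eq_natAbs]; omega⟩ hfH
    have hlast : A ^ m ≤ K * H := by
      refine le_trans ?_ (hb (Fin.last m))
      simp only [Fin.val_last]
      exact Nat.le_mul_of_pos_left _ (by omega)
    rw [hS, Finset.mem_coe, Finset.mem_biUnion]
    refine ⟨A, ?_, Finset.mem_image.2 ⟨(u, v), ?_, rfl⟩⟩
    · rw [Finset.mem_filter, Finset.mem_Icc]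
      exact ⟨⟨hA, (Nat.le_self_pow (by omega) A).trans hlast⟩, hlast⟩
    · rw [Finset.mem_product, Finset.mem_sdiff]
      simp only [boxU, boxV, Fintype.mem_piFinset, Finset.mem_Icc]
      refine ⟨fun k => ?_, fun j => ?_, fun hcon => ?_⟩
      · have := (Nat.le_div_iff_mul_le (by positivity)).2 (hb k)
        generalize K * H / A ^ (k : ℕ) = q at *
        omega
      · have := hi j (Finset.mem_univ _); omega
      · have := hcon i; omega
  have hcard : DStar d m n H ≤ S.card := by
    have : DStar d m n H = Set.ncard {f : ℤ[X] | f.natDegree = d ∧ f ≠ 0 ∧ HeightLe f H ∧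
      ∃ g h : ℤ[X], g.natDegree = m ∧ h.natDegree = n ∧ f = g.comp h} := rfl
    rw [this, ← Set.ncard_coe_finset]
    exact Set.ncard_le_ncard hsub (Finset.finite_toSet _)
  have hterm : ∀ A ∈ (Finset.Icc 1 (K * H)).filter (fun A => A ^ m ≤ K * H),
      (((boxU m A (K * H) ×ˢ (boxV n A \ boxV n (A - 1))).card : ℕ) : ℝ) ≤
        M * (H : ℝ) ^ (m + 1) * (A : ℝ)⁻¹ := by
    intro A hA
    rw [Finset.mem_filter, Finset.mem_Icc] at hA
    have h1 := card_boxU m n A (K * H) hA.1.1 hA.2 hcond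
    have h2 := card_shell n A hA.1.1
    have hA0 : (0 : ℝ) < A := by exact_mod_cast hA.1.1
    rw [Finset.card_product, ← div_eq_mul_inv, le_div_iff₀ hA0]
    push_cast at h1 ⊢
    have hP : (0 : ℝ) < (A : ℝ) ^ n := by positivity
    calc ((boxU m A (K * H)).card : ℝ) * ((boxV n A \ boxV n (A - 1)).card : ℝ) * A
        = (boxU m A (K * H)).card * (((boxV n A \ boxV n (A - 1)).card : ℝ) * A) := by ring
      _ ≤ (boxU m A (K * H)).card * (2 * n * 3 ^ n * (A : ℝ) ^ n) :=
          mul_le_mul_of_nonneg_left h2 (by positivity)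
      _ = 2 * n * 3 ^ n * ((boxU m A (K * H)).card * (A : ℝ) ^ n) := by ring
      _ ≤ 2 * n * 3 ^ n * (3 ^ (m + 1) * ((K : ℝ) * H) ^ (m + 1)) :=
          mul_le_mul_of_nonneg_left h1 (by positivity)
      _ = _ := by rw [hM, mul_pow]; ring
  have hKH : ((K * H : ℕ) : ℝ) = (K : ℝ) * H := by push_cast; rfl
  have hH0 : (0 : ℝ) < H := by positivity
  have hK0 : (0 : ℝ) < K := by exact_mod_cast hK
  have hharm : ∑ A ∈ Finset.Icc 1 (K * H), ((A : ℝ))⁻¹ ≤ 1 + Real.log (K * H) := by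
    have := harmonic_le_one_add_log (K * H)
    rw [harmonic_eq_sum_Icc] at this
    push_cast at this
    exact this
  have hlogH : Real.log 2 ≤ Real.log H := Real.log_le_log (by norm_num) (by exact_mod_cast hH)
  calc (DStar d m n H : ℝ) ≤ S.card := by exact_mod_cast hcard
    _ ≤ ∑ A ∈ (Finset.Icc 1 (K * H)).filter (fun A => A ^ m ≤ K * H),
        (((boxU m A (K * H) ×ˢ (boxV n A \ boxV n (A - 1))).card : ℕ) : ℝ) := by
        have : S.card ≤ ∑ A ∈ (Finset.Icc 1 (K * H)).filter (fun A => A ^ m ≤ K * H),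
          (boxU m A (K * H) ×ˢ (boxV n A \ boxV n (A - 1))).card :=
          Finset.card_biUnion_le.trans (Finset.sum_le_sum fun A _ => Finset.card_image_le)
        exact_mod_cast this
    _ ≤ ∑ A ∈ (Finset.Icc 1 (K * H)).filter (fun A => A ^ m ≤ K * H),
        M * (H : ℝ) ^ (m + 1) * (A : ℝ)⁻¹ := Finset.sum_le_sum hterm
    _ ≤ ∑ A ∈ Finset.Icc 1 (K * H), M * (H : ℝ) ^ (m + 1) * (A : ℝ)⁻¹ :=
        Finset.sum_le_sum_of_subset_of_nonneg (Finset.filter_subset _ _)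
          (fun _ _ _ => by positivity)
    _ = M * (H : ℝ) ^ (m + 1) * ∑ A ∈ Finset.Icc 1 (K * H), (A : ℝ)⁻¹ := by rw [Finset.mul_sum]
    _ ≤ M * (H : ℝ) ^ (m + 1) * (((1 + Real.log K) / Real.log 2 + 1) * Real.log H) := by
        refine mul_le_mul_of_nonneg_left (hharm.trans ?_) (by positivity)
        rw [Real.log_mul hK0.ne' hH0.ne', add_mul, one_mul, ← add_assoc]
        gcongr
        rw [div_mul_eq_mul_div, le_div_iff₀ hlog2]
        exact mul_le_mul_of_nonneg_left hlogH (by positivity)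
    _ = _ := by ring
end
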